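/- The simply graded Poincaré series of the pure trace algebras of two generic 3×3 and 4×4 matrices satisfy P(C_{3,2}; t) = (1 − t² + t⁴) / ((1−t)²(1−t²)⁴(1−t³)⁴) and P(C_{4,2}; t) = (1 − t² + t⁴)(1 − t − t³ + t⁴ + 2t⁵ + t⁶ − t⁷ − t⁹ + t¹⁰) / ((1−t)³(1−t²)⁴(1−t³)⁵(1−t⁴)⁵). -/

import Mathlib

open MvPolynomial Matrix

noncomputable section

/-- Index type for the entries of a pair of generic `n × n` matrices:
`Sum.inl (i,j)` indexes the `(i,j)` entry of `x`, `Sum.inr (i,j)` that of `y`. -/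
abbrev MatVar (n : ℕ) := (Fin n × Fin n) ⊕ (Fin n × Fin n)

/-- The substitution sending the variables to the entries of the pair `(A, B)`. -/
def pairSub {K : Type*} [CommSemiring K] {n : ℕ} (A B : Matrix (Fin n) (Fin n) K) :
    MatVar n → K
  | Sum.inl ij => A ij.1 ij.2
  | Sum.inr ij => B ij.1 ij.2

/-- A polynomial function on pairs of `n × n` matrices is `GLₙ`-invariant (for the action
by simultaneous conjugation). -/
def IsMatInvariant {K : Type*} [Field K] {n : ℕ} (f : MvPolynomial (MatVar n) K) : Prop :=
  ∀ (a : GL (Fin n) K) (A B : Matrix (Fin n) (Fin n) K),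
    MvPolynomial.eval
        (pairSub ((a : Matrix (Fin n) (Fin n) K) * A * ((a⁻¹ : GL (Fin n) K) : Matrix (Fin n) (Fin n) K))
          ((a : Matrix (Fin n) (Fin n) K) * B * ((a⁻¹ : GL (Fin n) K) : Matrix (Fin n) (Fin n) K))) f =
      MvPolynomial.eval (pairSub A B) f


/-- The homogeneous component of total degree `k` of the pure trace algebra `C_{n,2}`. -/
def pureComponent1 (K : Type*) [Field K] (n k : ℕ) : Set (MvPolynomial (MatVar n) K) :=
  {f | IsMatInvariant f ∧ f.IsHomogeneous k}

/-- `dim_K (C_{n,2})_k`. -/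
def pureDim1 (K : Type*) [Field K] (n k : ℕ) : ℕ :=
  Set.finrank K (pureComponent1 K n k)

/-- The simply graded Poincaré series `P(C_{n,2}; t)`. -/
def purePS1 (K : Type*) [Field K] (n : ℕ) : PowerSeries ℚ :=
  PowerSeries.mk fun k => (pureDim1 K n k : ℚ)

/-- The power series variable `t`. -/
def pu : PowerSeries ℚ := PowerSeries.X

/-- Laurent polynomials in `n` variables. -/
abbrev LP (K : Type*) [Field K] (n : ℕ) := AddMonoidAlgebra K (Fin n → ℤ)

namespace LPn
variable {K : Type*} [Field K] {n : ℕ}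

def mon (v : Fin n → ℤ) : LP K n := AddMonoidAlgebra.single v 1

lemma mon_mul (v w : Fin n → ℤ) : (mon v * mon w : LP K n) = mon (v + w) := by
  simp [mon, AddMonoidAlgebra.single_mul_single]

lemma mon_zero : (mon 0 : LP K n) = 1 := rfl

lemma single_eq (v : Fin n → ℤ) (r : K) :
    (AddMonoidAlgebra.single v r : LP K n) = r • mon v := by
  simp [mon]

/-- constant term -/
def ct : LP K n →ₗ[K] K where
  toFun f := f.coeff 0
  map_add' _ _ := by simp
  map_smul' _ _ := by simp

lemma ct_single (v : Fin n → ℤ) (r : K) :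
    ct (AddMonoidAlgebra.single v r : LP K n) = if v = 0 then r else 0 := by
  change (Finsupp.single v r) 0 = _
  rw [Finsupp.single_apply]

lemma single_sum {J : Type*} (s : Finset J) (v : Fin n → ℤ) (f : J → K) :
    (AddMonoidAlgebra.single v (∑ i ∈ s, f i) : LP K n) = ∑ i ∈ s, AddMonoidAlgebra.single v (f i) :=
  map_sum (AddMonoidAlgebra.singleAddHom v) f s

def thL (i : Fin n) : LP K n →ₗ[K] LP K n where
  toFun f := AddMonoidAlgebra.ofCoeff (Finsupp.ofSupportFinite (fun v => (v i : K) * f.coeff v)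
    (f.coeff.hasFiniteSupport.subset (by intro v; simp +contextual)))
  map_add' f g := by ext v; simp [Finsupp.ofSupportFinite, mul_add]
  map_smul' f g := by ext v; simp [Finsupp.ofSupportFinite]; ring

lemma thL_coeff (i : Fin n) (f : LP K n) (v) : (thL i f).coeff v = (v i : K) * f.coeff v := rfl

lemma thL_single (i : Fin n) (v : Fin n → ℤ) (r : K) :
    thL i (AddMonoidAlgebra.single v r : LP K n) = AddMonoidAlgebra.single v ((v i : K) * r) := by
  ext w
  rw [thL_coeff]
  simp only [AddMonoidAlgebra.coeff_single, Finsupp.single_apply]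
  split_ifs with h <;> simp [h]

def th (i : Fin n) : Derivation K (LP K n) (LP K n) :=
  Derivation.mk' (thL i) (by
    intro f g
    induction f using AddMonoidAlgebra.induction_linear with
    | zero => simp
    | add f1 f2 h1 h2 => simp only [add_mul, map_add, h1, h2, smul_eq_mul, mul_add]; ring
    | single v r =>
      induction g using AddMonoidAlgebra.induction_linear with
      | zero => simp
      | add f1 f2 h1 h2 => simp only [add_mul, map_add, h1, h2, smul_eq_mul, mul_add]; ring
      | single w s =>
        simp only [thL_single, AddMonoidAlgebra.single_mul_single, smul_eq_mul, add_comm w v]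
        rw [← AddMonoidAlgebra.single_add]
        congr 1
        simp; ring)

lemma th_single (i : Fin n) (v : Fin n → ℤ) (r : K) :
    th i (AddMonoidAlgebra.single v r : LP K n) = AddMonoidAlgebra.single v ((v i : K) * r) :=
  thL_single i v r

lemma th_mon (i : Fin n) (v : Fin n → ℤ) : th i (mon v : LP K n) = (v i : K) • mon v := by
  rw [mon, th_single]; simp

lemma ct_th (i : Fin n) (f : LP K n) : ct (th i f) = 0 := by
  change (thL i f).coeff 0 = 0
  rw [thL_coeff]; simp

/-- variables -/
def xv (i : Fin n) : LP K n := mon (Pi.single i 1)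
def yv (i : Fin n) : LP K n := mon (-Pi.single i 1)

lemma xv_mul_yv (i : Fin n) : (xv i * yv i : LP K n) = 1 := by
  simp [xv, yv, mon_mul, mon_zero]

lemma th_xv (i j : Fin n) : th i (xv j : LP K n) = if i = j then xv j else 0 := by
  rw [xv, th_mon]; by_cases h : i = j <;> simp [h]

lemma th_yv (i j : Fin n) : th i (yv j : LP K n) = if i = j then - yv j else 0 := by
  rw [yv, th_mon]; by_cases h : i = j <;> simp [h]

/-- weighted trace -/
def ch {I : Type*} [Fintype I] (wt : I → Fin n → ℤ) (B : Matrix I I K) : LP K n :=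
  ∑ s, AddMonoidAlgebra.single (wt s) (B s s)

section
variable {I : Type*} [Fintype I] (wt : I → Fin n → ℤ)

lemma ch_add (B C : Matrix I I K) : ch wt (B + C) = ch wt B + ch wt C := by
  simp [ch, Finset.sum_add_distrib]

lemma ch_sub (B C : Matrix I I K) : ch wt (B - C) = ch wt B - ch wt C := by
  rw [eq_sub_iff_add_eq, ← ch_add, sub_add_cancel]

lemma ch_sum {J : Type*} (s : Finset J) (B : J → Matrix I I K) :
    ch wt (∑ j ∈ s, B j) = ∑ j ∈ s, ch wt (B j) := by
  classical
  induction s using Finset.induction_on with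
  | empty => simp [ch]
  | insert a s ha ih => rw [Finset.sum_insert ha, Finset.sum_insert ha, ch_add, ih]

lemma ch_cyc (α : Fin n → ℤ) (E B : Matrix I I K)
    (hE : ∀ u s, E u s ≠ 0 → wt u = wt s + α) :
    ch wt (E * B) = mon α * ch wt (B * E) := by
  simp only [ch, Matrix.mul_apply, single_sum, Finset.mul_sum]
  rw [Finset.sum_comm]
  refine Finset.sum_congr rfl fun s _ => Finset.sum_congr rfl fun u _ => ?_
  rw [mon, AddMonoidAlgebra.single_mul_single, one_mul, mul_comm (B s u)]
  by_cases h : E u s = 0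
  · simp [h]
  · rw [hE u s h, add_comm]

lemma ch_diag [DecidableEq I] (i : Fin n) (B : Matrix I I K) :
    ch wt (B * Matrix.diagonal (fun s => (wt s i : K))) = th i (ch wt B) := by
  simp only [ch, map_sum, th_single, Matrix.mul_diagonal]
  refine Finset.sum_congr rfl fun s _ => ?_
  rw [mul_comm]

theorem weyl_abstract [DecidableEq I] (E : Fin n → Fin n → Matrix I I K) (A : Matrix I I K)
    (hdiag : ∀ i, E i i = Matrix.diagonal (fun s => (wt s i : K)))
    (hwt : ∀ i j u s, E i j u s ≠ 0 → wt u = wt s + (Pi.single i 1 - Pi.single j 1))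
    (hcomm : ∀ i j, E i j * E j i - E j i * E i j = E i i - E j j)
    (hA : ∀ i j, E i j * A = A * E i j)
    (hsum : ∀ s, ∑ i, wt s i = 0)
    (Δ Δb : LP K n) (D : Fin n → Fin n → LP K n) (c : K)
    (h1 : ∀ i, th i Δ = ∑ j, xv i * D i j)
    (h2 : ∀ i j, i ≠ j → Δ = (xv i - xv j) * D i j)
    (h3 : ∀ i j, D i j = - D j i) (h3' : ∀ i, D i i = 0)
    (h4 : ∑ i, th i (th i Δ) = c • Δ) (h4' : ∑ i, th i (th i Δb) = c • Δb) :
    ct (Δ * Δb * ch wt (A * ∑ i, ∑ j, E i j * E j i)) = 0 := by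
  set χ := ch wt A with hχ
  set Ψ : Fin n → Fin n → LP K n := fun i j => ch wt (A * (E i j * E j i)) with hΨ
  have hΩ : ch wt (A * ∑ i, ∑ j, E i j * E j i) = ∑ i, ∑ j, Ψ i j := by
    simp only [Finset.mul_sum, ch_sum, hΨ]
  have e1 : ∀ i j, xv j * Ψ i j = xv i * Ψ j i := by
    intro i j
    have : Ψ i j = mon (Pi.single i 1 - Pi.single j 1) * Ψ j i := by
      simp only [hΨ]
      rw [← mul_assoc, ← hA, mul_assoc, ch_cyc wt _ (E i j) _ (hwt i j), mul_assoc]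
    rw [this, ← mul_assoc, xv, mon_mul, xv]
    congr 2; abel
  have e2 : ∀ i j, Ψ i j - Ψ j i = th i χ - th j χ := by
    intro i j
    simp only [hΨ]
    rw [← ch_sub, ← mul_sub, hcomm, mul_sub, ch_sub, hdiag, hdiag, ch_diag, ch_diag]
  have e3 : ∀ i, Ψ i i = th i (th i χ) := by
    intro i
    simp only [hΨ]
    rw [← mul_assoc, hdiag, ch_diag, ch_diag]
  have e4 : ∑ i, th i χ = 0 := by
    have : ∀ i, th i χ = ∑ s, AddMonoidAlgebra.single (wt s) ((wt s i : K) * A s s) := by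
      intro i; simp only [hχ, ch, map_sum, th_single]
    simp only [this]
    rw [Finset.sum_comm]
    refine Finset.sum_eq_zero fun s _ => ?_
    rw [← single_sum, ← Finset.sum_mul]
    have := hsum s
    have h' : ∑ i, (wt s i : K) = 0 := by exact_mod_cast congrArg (Int.cast : ℤ → K) this
    rw [h']; simp
  have e5 : ∀ i j, i ≠ j → Δ * Ψ i j = D i j * xv i * (th i χ - th j χ) := by
    intro i j hij
    rw [h2 i j hij, ← e2]
    linear_combination -D i j * e1 i j
  -- key
  have key : Δ * ∑ i, ∑ j, Ψ i j = (∑ i, th i (th i (Δ * χ))) - c • (Δ * χ) := by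
    have l : ∀ i, th i (th i (Δ * χ)) =
        th i (th i Δ) * χ + 2 * (th i Δ * th i χ) + Δ * th i (th i χ) := by
      intro i; simp only [Derivation.leibniz, smul_eq_mul, map_add]; ring
    simp only [l, Finset.sum_add_distrib, ← Finset.sum_mul, h4, smul_mul_assoc]
    have s1 : Δ * ∑ i, ∑ j, Ψ i j = Δ * ∑ i, th i (th i χ)
        + ∑ i, ∑ j, D i j * xv i * (th i χ - th j χ) := by
      simp only [Finset.mul_sum, ← Finset.sum_add_distrib]
      refine Finset.sum_congr rfl fun i _ => ?_
      have : ∀ j, Δ * Ψ i j = (if j = i then Δ * th i (th i χ) else 0)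
          + D i j * xv i * (th i χ - th j χ) := by
        intro j
        by_cases h : j = i
        · subst h; simp [e3]
        · simp [h, e5 i j (Ne.symm h)]
      simp only [this, Finset.sum_add_distrib]
      simp
    have s2 : ∑ i, ∑ j, D i j * xv i * (th i χ - th j χ)
        = ∑ i, ∑ j, (D i j * (xv i + xv j)) * th i χ := by
      have t1 : ∑ i, ∑ j, D i j * xv i * (th i χ - th j χ) =
        ∑ i, ∑ j, D i j * xv i * th i χ - ∑ i, ∑ j, D i j * xv i * th j χ := by
        simp only [mul_sub, Finset.sum_sub_distrib]
      rw [t1, Finset.sum_comm (f := fun i j => D i j * xv i * th j χ)]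
      rw [← Finset.sum_sub_distrib]
      refine Finset.sum_congr rfl fun i _ => ?_
      rw [← Finset.sum_sub_distrib]
      refine Finset.sum_congr rfl fun j _ => ?_
      rw [h3 j i]; ring
    have s3 : ∀ i, ∑ j, D i j * (xv i + xv j) = 2 * th i Δ - ((n : LP K n) - 1) * Δ := by
      intro i
      have : ∀ j, D i j * (xv i + xv j) = 2 * (xv i * D i j) - Δ + if j = i then Δ else 0 := by
        intro j
        by_cases h : j = i
        · subst h; simp [h3']
        · simp only [h, if_false]
          linear_combination h2 i j (Ne.symm h)
      simp only [this, Finset.sum_add_distrib, Finset.sum_sub_distrib, ← Finset.mul_sum, ← h1]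
      simp
      ring
    rw [s1, s2]
    simp only [← Finset.sum_mul, s3]
    simp only [sub_mul, Finset.sum_sub_distrib, mul_assoc, ← Finset.mul_sum, e4]
    rw [Finset.mul_sum]
    ring
  have parts : ∀ (i : Fin n) (f g : LP K n), ct (g * th i (th i f)) = ct (th i (th i g) * f) := by
    intro i f g
    have a1 := ct_th i (g * th i f)
    have a2 := ct_th i (th i g * f)
    simp only [Derivation.leibniz, smul_eq_mul, map_add] at a1 a2
    rw [mul_comm f, mul_comm (th i f)] at *
    linear_combination a1 - a2
  rw [hΩ, mul_comm Δ, mul_assoc, key, mul_sub, map_sub, Finset.mul_sum, map_sum]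
  simp only [parts]
  rw [← map_sum, ← Finset.sum_mul, h4']
  simp
end
end LPn

namespace LPn
variable {K : Type*} [Field K] {n : ℕ}

def van3 (x : Fin 3 → LP K n) : LP K n := (x 0 - x 1) * (x 0 - x 2) * (x 1 - x 2)
def D3 (x : Fin 3 → LP K n) : Fin 3 → Fin 3 → LP K n :=
  ![![0, (x 0 - x 2) * (x 1 - x 2), (x 0 - x 1) * (x 1 - x 2)],
    ![-((x 0 - x 2) * (x 1 - x 2)), 0, (x 0 - x 1) * (x 0 - x 2)],
    ![-((x 0 - x 1) * (x 1 - x 2)), -((x 0 - x 1) * (x 0 - x 2)), 0]]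

def van4 (x : Fin 4 → LP K n) : LP K n :=
  (x 0 - x 1) * (x 0 - x 2) * (x 0 - x 3) * (x 1 - x 2) * (x 1 - x 3) * (x 2 - x 3)
def D4u (x : Fin 4 → LP K n) : Fin 4 → Fin 4 → LP K n :=
  ![![0, (x 0 - x 2) * (x 0 - x 3) * (x 1 - x 2) * (x 1 - x 3) * (x 2 - x 3),
      (x 0 - x 1) * (x 0 - x 3) * (x 1 - x 2) * (x 1 - x 3) * (x 2 - x 3),
      (x 0 - x 1) * (x 0 - x 2) * (x 1 - x 2) * (x 1 - x 3) * (x 2 - x 3)],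
    ![0, 0, (x 0 - x 1) * (x 0 - x 2) * (x 0 - x 3) * (x 1 - x 3) * (x 2 - x 3),
      (x 0 - x 1) * (x 0 - x 2) * (x 0 - x 3) * (x 1 - x 2) * (x 2 - x 3)],
    ![0, 0, 0, (x 0 - x 1) * (x 0 - x 2) * (x 0 - x 3) * (x 1 - x 2) * (x 1 - x 3)],
    ![0, 0, 0, 0]]
def D4 (x : Fin 4 → LP K n) (i j : Fin 4) : LP K n := D4u x i j - D4u x j i

lemma ofNat_smul_LP (m : ℕ) (f : LP K n) : (m : K) • f = (m : LP K n) * f := by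
  rw [Algebra.smul_def]; simp

theorem weyl3 {I : Type*} [Fintype I] (wt : I → Fin 3 → ℤ) [DecidableEq I]
    (E : Fin 3 → Fin 3 → Matrix I I K) (A : Matrix I I K)
    (hdiag : ∀ i, E i i = Matrix.diagonal (fun s => (wt s i : K)))
    (hwt : ∀ i j u s, E i j u s ≠ 0 → wt u = wt s + (Pi.single i 1 - Pi.single j 1))
    (hcomm : ∀ i j, E i j * E j i - E j i * E i j = E i i - E j j)
    (hA : ∀ i j, E i j * A = A * E i j)
    (hsum : ∀ s, ∑ i, wt s i = 0) :
    ct (van3 xv * van3 yv * ch wt (A * ∑ i, ∑ j, E i j * E j i)) = 0 := by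
  apply weyl_abstract wt E A hdiag hwt hcomm hA hsum (van3 xv) (van3 yv) (D3 xv) ((5 : ℕ) : K)
  · intro i
    fin_cases i <;>
    · simp [Fin.sum_univ_three, D3, van3, th_xv, Derivation.leibniz]; ring
  · intro i j hij
    fin_cases i <;> fin_cases j <;> first | (exact absurd rfl hij) | (simp [D3, van3]; ring)
  · intro i j
    fin_cases i <;> fin_cases j <;> simp [D3]
  · intro i
    fin_cases i <;> simp [D3]
  · rw [ofNat_smul_LP]
    simp [Fin.sum_univ_three, van3, th_xv, Derivation.leibniz]; ring
  · rw [ofNat_smul_LP]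
    simp [Fin.sum_univ_three, van3, th_yv, Derivation.leibniz]; ring

theorem weyl4 {I : Type*} [Fintype I] (wt : I → Fin 4 → ℤ) [DecidableEq I]
    (E : Fin 4 → Fin 4 → Matrix I I K) (A : Matrix I I K)
    (hdiag : ∀ i, E i i = Matrix.diagonal (fun s => (wt s i : K)))
    (hwt : ∀ i j u s, E i j u s ≠ 0 → wt u = wt s + (Pi.single i 1 - Pi.single j 1))
    (hcomm : ∀ i j, E i j * E j i - E j i * E i j = E i i - E j j)
    (hA : ∀ i j, E i j * A = A * E i j)
    (hsum : ∀ s, ∑ i, wt s i = 0) :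
    ct (van4 xv * van4 yv * ch wt (A * ∑ i, ∑ j, E i j * E j i)) = 0 := by
  apply weyl_abstract wt E A hdiag hwt hcomm hA hsum (van4 xv) (van4 yv) (D4 xv) ((14 : ℕ) : K)
  · intro i
    fin_cases i <;>
    · simp [Fin.sum_univ_four, D4, D4u, van4, th_xv, Derivation.leibniz]; ring
  · intro i j hij
    fin_cases i <;> fin_cases j <;> first | (exact absurd rfl hij) | (simp [D4, D4u, van4]; ring)
  · intro i j
    simp [D4]
  · intro i
    simp [D4]
  · rw [ofNat_smul_LP]
    simp [Fin.sum_univ_four, van4, th_xv, Derivation.leibniz]; ring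
  · rw [ofNat_smul_LP]
    simp [Fin.sum_univ_four, van4, th_yv, Derivation.leibniz]; ring
end LPn

namespace LPn

lemma cas_comm {R : Type*} [Ring R] {n : ℕ} (E : Fin n → Fin n → R)
    (h : ∀ i j k l, E i j * E k l - E k l * E i j =
      (if j = k then E i l else 0) - (if i = l then E k j else 0)) (k l : Fin n) :
    E k l * ∑ i, ∑ j, E i j * E j i = (∑ i, ∑ j, E i j * E j i) * E k l := by
  rw [← sub_eq_zero]
  have e : ∀ i j, E k l * (E i j * E j i) - E i j * E j i * E k l =
      (if l = i then E k j * E j i else 0) - (if k = j then E i l * E j i else 0)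
      + (if l = j then E i j * E k i else 0) - (if k = i then E i j * E j l else 0) := by
    intro i j
    have h1 := h k l i j
    have h2 := h k l j i
    have : E k l * (E i j * E j i) - E i j * E j i * E k l =
      (E k l * E i j - E i j * E k l) * E j i + E i j * (E k l * E j i - E j i * E k l) := by
      noncomm_ring
    rw [this, h1, h2]
    simp only [sub_mul, mul_sub, ite_mul, mul_ite, zero_mul, mul_zero]
    abel
  simp only [Finset.mul_sum, Finset.sum_mul, ← Finset.sum_sub_distrib, e]
  simp only [Finset.sum_sub_distrib, Finset.sum_add_distrib]
  simp only [Finset.sum_ite_eq, Finset.mem_univ, if_true]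
  rw [Finset.sum_comm (f := fun i j => if l = i then E k j * E j i else 0),
    Finset.sum_comm (f := fun i j => if k = i then E i j * E j l else 0)]
  simp only [Finset.sum_ite_eq, Finset.mem_univ, if_true]
  abel

variable {I : Type*} [Fintype I] [DecidableEq I] {n : ℕ}

lemma exists_poly (E : Fin n → Fin n → Matrix I I ℚ) (d : I → ℚ) (hd : ∀ s, 0 < d s)
    (hadj : ∀ i j u s, d u * E i j u s = d s * E j i s u) :
    ∃ p : Polynomial ℚ, ∀ i j, E i j * (1 + Polynomial.aeval (∑ i, ∑ j, E i j * E j i) p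
      * ∑ i, ∑ j, E i j * E j i) = 0 := by
  set Ω := ∑ i, ∑ j, E i j * E j i with hΩ
  let B : (I → ℚ) → (I → ℚ) → ℚ := fun v w => ∑ s, d s * v s * w s
  have hB0 : ∀ v, B v v = 0 → v = 0 := by
    intro v hv
    have h := (Finset.sum_eq_zero_iff_of_nonneg (fun s _ => by
      have := (hd s).le
      have := mul_self_nonneg (v s)
      rw [mul_assoc]; positivity)).1 hv
    funext s
    have := h s (Finset.mem_univ s)
    have hs := (hd s).ne'
    simpa [hs] using this
  have hBpos : ∀ v, 0 ≤ B v v := fun v => Finset.sum_nonneg (fun s _ => by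
      have := (hd s).le
      have := mul_self_nonneg (v s)
      rw [mul_assoc]; positivity)
  have hBE : ∀ i j v w, B (E i j *ᵥ v) w = B v (E j i *ᵥ w) := by
    intro i j v w
    simp only [B, Matrix.mulVec, dotProduct, Finset.mul_sum, Finset.sum_mul]
    rw [Finset.sum_comm]
    refine Finset.sum_congr rfl fun s _ => Finset.sum_congr rfl fun u _ => ?_
    linear_combination (v s * w u) * hadj i j u s
  have hsum : ∀ v w, B (Ω *ᵥ v) w = ∑ i, ∑ j, B (E j i *ᵥ v) (E j i *ᵥ w) := by
    intro v w
    have : ∀ i j, B ((E i j * E j i) *ᵥ v) w = B (E j i *ᵥ v) (E j i *ᵥ w) := by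
      intro i j
      rw [← Matrix.mulVec_mulVec, hBE]
    simp only [← this]
    have hadd : ∀ {ι : Type} (t : Finset ι) (f : ι → Matrix I I ℚ),
        B ((∑ i ∈ t, f i) *ᵥ v) w = ∑ i ∈ t, B (f i *ᵥ v) w := by
      intro ι t f
      simp only [B, Matrix.sum_mulVec, Finset.sum_apply, Finset.mul_sum, Finset.sum_mul]
      rw [Finset.sum_comm]
    rw [hΩ, hadd]
    refine Finset.sum_congr rfl fun i _ => ?_
    rw [hadd]
  have hk : ∀ v, Ω *ᵥ v = 0 → ∀ i j, E i j *ᵥ v = 0 := by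
    intro v hv i j
    have h1 := hsum v v
    rw [hv] at h1
    have h2 : B 0 v = 0 := by simp [B]
    rw [h2] at h1
    have h3 := (Finset.sum_eq_zero_iff_of_nonneg (fun i _ =>
      Finset.sum_nonneg (fun j _ => hBpos _))).1 h1.symm j (Finset.mem_univ j)
    have h4 := (Finset.sum_eq_zero_iff_of_nonneg (fun j _ => hBpos _)).1 h3 i (Finset.mem_univ i)
    exact hB0 _ h4
  have hsq : ∀ v, Ω *ᵥ (Ω *ᵥ v) = 0 → Ω *ᵥ v = 0 := by
    intro v hv
    have := hk _ hv
    apply hB0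
    rw [hsum]
    refine Finset.sum_eq_zero fun i _ => Finset.sum_eq_zero fun j _ => ?_
    rw [this]; simp [B]
  have hpow : ∀ a v, (Ω ^ a) *ᵥ v = 0 → Ω *ᵥ v = 0 := by
    intro a
    induction a with
    | zero => intro v hv; simp at hv; simp [hv]
    | succ a ih =>
      intro v hv
      apply hsq
      apply ih
      rw [Matrix.mulVec_mulVec, ← pow_succ]; exact hv
  have hc0 : Ω.charpoly ≠ 0 := (Matrix.charpoly_monic Ω).ne_zero
  obtain ⟨q, hq, hq0⟩ := Polynomial.exists_eq_pow_rootMultiplicity_mul_and_not_dvd _ hc0 0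
  rw [map_zero, sub_zero] at hq hq0
  rw [Polynomial.X_dvd_iff] at hq0
  set a := Polynomial.rootMultiplicity 0 Ω.charpoly
  have hch := Matrix.aeval_self_charpoly Ω
  rw [hq, map_mul, map_pow, Polynomial.aeval_X] at hch
  have hEq : ∀ i j, E i j * Polynomial.aeval Ω q = 0 := by
    intro i j
    apply Matrix.ext_of_mulVec_single
    intro s
    rw [← Matrix.mulVec_mulVec, Matrix.zero_mulVec]
    apply hk
    apply hpow a
    rw [Matrix.mulVec_mulVec, hch, Matrix.zero_mulVec]
  refine ⟨Polynomial.C (q.coeff 0)⁻¹ * q.divX, fun i j => ?_⟩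
  have : (1 : Matrix I I ℚ) + Polynomial.aeval Ω (Polynomial.C (q.coeff 0)⁻¹ * q.divX) * Ω
      = (q.coeff 0)⁻¹ • Polynomial.aeval Ω q := by
    have hqq := congrArg (Polynomial.aeval Ω) (Polynomial.divX_mul_X_add q)
    rw [← hqq]
    simp only [map_add, map_mul, Polynomial.aeval_X, Polynomial.aeval_C, smul_add]
    rw [Algebra.algebraMap_eq_smul_one, Algebra.algebraMap_eq_smul_one, smul_smul,
      inv_mul_cancel₀ hq0, one_smul, add_comm]
    simp
  rw [this, mul_smul_comm, hEq, smul_zero]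

theorem mol_abstract {K : Type*} [Field K] [CharZero K] (wt : I → Fin n → ℤ)
    (EZ : Fin n → Fin n → Matrix I I ℤ)
    (d : I → ℕ) (hd : ∀ s, 0 < d s)
    (hadj : ∀ i j u s, (d u : ℤ) * EZ i j u s = d s * EZ j i s u)
    (hdiag : ∀ i, EZ i i = Matrix.diagonal (fun s => wt s i))
    (hcomm : ∀ i j k l, EZ i j * EZ k l - EZ k l * EZ i j =
      (if j = k then EZ i l else 0) - (if i = l then EZ k j else 0))
    (Δ : LP K n)
    (hweyl : ∀ A : Matrix I I K, (∀ i j, (EZ i j).map (Int.cast : ℤ → K) * A =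
        A * (EZ i j).map (Int.cast : ℤ → K)) →
      ct (Δ * ch wt (A * ∑ i, ∑ j, (EZ i j).map (Int.cast : ℤ → K) *
        (EZ j i).map (Int.cast : ℤ → K))) = 0)
    (V : Submodule K (I → K))
    (hV : ∀ v, v ∈ V ↔ ∀ i j, (EZ i j).map (Int.cast : ℤ → K) *ᵥ v = 0) :
    ct (Δ * ch wt (1 : Matrix I I K)) = (Module.finrank K V : K) * ct Δ := by
  obtain ⟨p, hp⟩ := exists_poly (fun i j => (EZ i j).map (Int.cast : ℤ → ℚ))
    (fun s => (d s : ℚ)) (fun s => by exact_mod_cast hd s)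
    (fun i j u s => by simp only [Matrix.map_apply]; exact_mod_cast hadj i j u s)
  set EQ : Fin n → Fin n → Matrix I I ℚ := fun i j => (EZ i j).map (Int.cast : ℤ → ℚ) with hEQ
  set E : Fin n → Fin n → Matrix I I K := fun i j => (EZ i j).map (Int.cast : ℤ → K) with hE
  set ΩQ := ∑ i, ∑ j, EQ i j * EQ j i with hΩQ
  set Ω := ∑ i, ∑ j, E i j * E j i with hΩ
  let φ : Matrix I I ℚ →ₐ[ℚ] Matrix I I K := (Algebra.ofId ℚ K).mapMatrix
  have hφE : ∀ i j, φ (EQ i j) = E i j := by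
    intro i j; ext u s; simp [φ, EQ, E]
  have hφΩ : φ ΩQ = Ω := by simp [ΩQ, Ω, map_sum, hφE]
  set A : Matrix I I K := Polynomial.aeval Ω p with hA
  have hφA : φ (Polynomial.aeval ΩQ p) = A := by
    rw [← Polynomial.aeval_algHom_apply, hφΩ]
  set T := 1 + A * Ω with hT
  have hET : ∀ i j, E i j * T = 0 := by
    intro i j
    have := congrArg φ (hp i j)
    rw [map_mul, map_add, map_one, map_mul, hφA, map_zero] at this
    erw [hφΩ, hφE] at this
    exact this
  have hcommK : ∀ i j k l, E i j * E k l - E k l * E i j =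
      (if j = k then E i l else 0) - (if i = l then E k j else 0) := by
    intro i j k l
    have := congrArg (Int.castRingHom K).mapMatrix (hcomm i j k l)
    simp only [map_sub, map_mul, apply_ite (Int.castRingHom K).mapMatrix, map_zero] at this
    exact this
  have hAE : ∀ i j, E i j * A = A * E i j := by
    intro i j
    have h1 : Commute (E i j) Ω := cas_comm E hcommK i j
    have : ∀ p : Polynomial ℚ, Commute (E i j) (Polynomial.aeval Ω p) := by
      intro p
      induction p using Polynomial.induction_on' with
      | add p q hp hq => rw [map_add]; exact hp.add_right hq
      | monomial m a =>
        rw [Polynomial.aeval_monomial]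
        exact (Algebra.commute_algebraMap_right _ _).mul_right (h1.pow_right m)
    exact this p
  have hproj : LinearMap.IsProj V (Matrix.toLin' T) := by
    constructor
    · intro v
      rw [hV]
      intro i j
      change E i j *ᵥ _ = 0
      rw [Matrix.toLin'_apply, Matrix.mulVec_mulVec, hET, Matrix.zero_mulVec]
    · intro v hv
      rw [hV] at hv
      rw [Matrix.toLin'_apply, hT, Matrix.add_mulVec, Matrix.one_mulVec, ← Matrix.mulVec_mulVec]
      have : Ω *ᵥ v = 0 := by
        rw [hΩ, Matrix.sum_mulVec]
        refine Finset.sum_eq_zero fun i _ => ?_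
        rw [Matrix.sum_mulVec]
        refine Finset.sum_eq_zero fun j _ => ?_
        rw [← Matrix.mulVec_mulVec]
        change E i j *ᵥ ((EZ j i).map (Int.cast : ℤ → K) *ᵥ v) = 0
        rw [hv, Matrix.mulVec_zero]
      rw [this]; simp
  have htr : T.trace = (Module.finrank K V : K) := by
    rw [← hproj.trace, ← Matrix.trace_toLin'_eq]
  have hchT : ch wt T = T.trace • (1 : LP K n) := by
    rw [ch, Matrix.trace, Finset.sum_smul]
    refine Finset.sum_congr rfl fun s _ => ?_
    have h : ∀ i, (wt s i : K) * T s s = 0 := by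
      intro i
      have := congrFun (congrFun (hET i i) s) s
      simp only [E, hdiag] at this
      rw [Matrix.diagonal_map (by simp), Matrix.diagonal_mul] at this
      exact this
    by_cases h0 : T s s = 0
    · simp [h0]
    · have : wt s = 0 := by
        funext i
        have := h i
        simpa [h0] using this
      rw [this, single_eq, mon_zero]; rfl
  have h1 : ch wt T = ch wt 1 + ch wt (A * Ω) := by rw [hT, ch_add]
  have h2 : ct (Δ * ch wt (A * Ω)) = 0 := hweyl A hAE
  have h3 : ct (Δ * ch wt T) = ct (Δ * ch wt (1 : Matrix I I K)) := by
    rw [h1, mul_add, map_add, h2, add_zero]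
  rw [← h3, hchT, htr]
  simp
end LPn

namespace LPn

variable {n : ℕ}

def mv (c : Bool) (p q : Fin n) : MatVar n := if c then Sum.inl (p, q) else Sum.inr (p, q)

lemma mv_surj (v : MatVar n) : ∃ c p q, v = mv c p q := by
  rcases v with ⟨p, q⟩ | ⟨p, q⟩
  · exact ⟨true, p, q, rfl⟩
  · exact ⟨false, p, q, rfl⟩

lemma mv_inj (c c' : Bool) (p q p' q' : Fin n) :
    mv c p q = mv c' p' q' ↔ c = c' ∧ p = p' ∧ q = q' := by
  cases c <;> cases c' <;> simp [mv]

lemma sum_mv {M : Type*} [AddCommMonoid M] (f : MatVar n → M) :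
    ∑ v, f v = ∑ c, ∑ p, ∑ q, f (mv c p q) := by
  simp [Fintype.sum_sum_type, Fintype.sum_prod_type, mv]

def wtv : MatVar n → Fin n → ℤ
  | Sum.inl (p, q) => Pi.single q 1 - Pi.single p 1
  | Sum.inr (p, q) => Pi.single q 1 - Pi.single p 1

lemma wtv_mv (c : Bool) (p q : Fin n) : wtv (mv c p q) = Pi.single q 1 - Pi.single p 1 := by
  cases c <;> rfl

def wts (s : MatVar n →₀ ℕ) : Fin n → ℤ := ∑ v, (s v : ℤ) • wtv v

lemma wts_add (s u : MatVar n →₀ ℕ) : wts (s + u) = wts s + wts u := by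
  simp [wts, add_smul, Finset.sum_add_distrib]

lemma wts_single (v : MatVar n) : wts (Finsupp.single v 1) = wtv v := by
  classical
  simp only [wts, Finsupp.single_apply]
  rw [Finset.sum_eq_single v]
  · simp
  · intro b _ hb; simp [Ne.symm hb]
  · simp

lemma wts_sum (s : MatVar n →₀ ℕ) : ∑ i, wts s i = 0 := by
  simp only [wts, Finset.sum_apply]
  rw [Finset.sum_comm]
  refine Finset.sum_eq_zero fun v _ => ?_
  obtain ⟨c, p, q, rfl⟩ := mv_surj v
  simp [wtv_mv, ← Finset.mul_sum]

def Nf (a b : MatVar n) (u s : MatVar n →₀ ℕ) : ℤ :=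
  if u + Finsupp.single b 1 = s + Finsupp.single a 1 then (s b : ℤ) else 0

abbrev Idx (n k : ℕ) := {s : MatVar n →₀ ℕ // s ∈ Finset.finsuppAntidiag Finset.univ k}

def EZ (k : ℕ) (i j : Fin n) : Matrix (Idx n k) (Idx n k) ℤ := fun u s =>
  ∑ c, ∑ p, Nf (mv c p i) (mv c p j) u.1 s.1 - ∑ c, ∑ q, Nf (mv c j q) (mv c i q) u.1 s.1

def fct (s : MatVar n →₀ ℕ) : ℕ := ∏ v, (s v).factorial

lemma fct_pos (s : MatVar n →₀ ℕ) : 0 < fct s := Finset.prod_pos fun v _ => Nat.factorial_pos _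

lemma fct_add (s : MatVar n →₀ ℕ) (a : MatVar n) :
    fct (s + Finsupp.single a 1) = (s a + 1) * fct s := by
  classical
  simp only [fct]
  rw [← Finset.mul_prod_erase _ _ (Finset.mem_univ a), ← Finset.mul_prod_erase _ (fun v => (s v).factorial) (Finset.mem_univ a)]
  have : ∀ v ∈ Finset.univ.erase a, ((s + Finsupp.single a 1 : MatVar n →₀ ℕ) v).factorial = (s v).factorial := by
    intro v hv
    simp [Finsupp.single_apply, (Finset.ne_of_mem_erase hv).symm]
  rw [Finset.prod_congr rfl this]
  simp [Nat.factorial_succ, mul_assoc]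

lemma Nf_adj (a b : MatVar n) (u s : MatVar n →₀ ℕ) :
    (fct u : ℤ) * Nf a b u s = fct s * Nf b a s u := by
  classical
  simp only [Nf]
  by_cases h : u + Finsupp.single b 1 = s + Finsupp.single a 1
  · rw [if_pos h, if_pos h.symm]
    by_cases hab : a = b
    · subst hab
      have : u = s := by simpa using h
      rw [this]
    · have h1 := congrArg fct h
      rw [fct_add, fct_add] at h1
      have h2 := DFunLike.congr_fun h a
      have h3 := DFunLike.congr_fun h b
      simp [Finsupp.single_apply, hab, Ne.symm hab] at h2 h3
      rw [h2, ← h3]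
      push_cast
      have h1' : ((u b + 1) * fct u : ℤ) = (s a + 1) * fct s := by exact_mod_cast h1
      linear_combination h1'
  · rw [if_neg h, if_neg (fun h' => h h'.symm)]; simp

lemma EZ_adj (k : ℕ) (i j : Fin n) (u s : Idx n k) :
    (fct u.1 : ℤ) * EZ k i j u s = fct s.1 * EZ k j i s u := by
  simp only [EZ, mul_sub, Finset.mul_sum, Nf_adj]

lemma Nf_wt (a b : MatVar n) (u s : MatVar n →₀ ℕ) (h : Nf a b u s ≠ 0) :
    wts u = wts s + (wtv a - wtv b) := by
  have h' : u + Finsupp.single b 1 = s + Finsupp.single a 1 := by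
    by_contra h0; exact h (if_neg h0)
  have := congrArg wts h'
  rw [wts_add, wts_add, wts_single, wts_single] at this
  rw [← add_sub_assoc, ← this]; abel

lemma EZ_wt (k : ℕ) (i j : Fin n) (u s : Idx n k) (h : EZ k i j u s ≠ 0) :
    wts u.1 = wts s.1 + (Pi.single i 1 - Pi.single j 1) := by
  by_contra hne
  apply h
  have h1 : ∀ c p, Nf (mv c p i) (mv c p j) u.1 s.1 = 0 := by
    intro c p
    by_contra h0
    apply hne
    rw [Nf_wt _ _ _ _ h0, wtv_mv, wtv_mv]; abel
  have h2 : ∀ c p, Nf (mv c j p) (mv c i p) u.1 s.1 = 0 := by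
    intro c p
    by_contra h0
    apply hne
    rw [Nf_wt _ _ _ _ h0, wtv_mv, wtv_mv]; abel
  simp [EZ, h1, h2]

lemma EZ_diag (k : ℕ) (i : Fin n) :
    EZ k i i = Matrix.diagonal (fun s : Idx n k => wts s.1 i) := by
  classical
  ext u s
  rw [Matrix.diagonal_apply]
  by_cases h : u = s
  · subst h
    simp only [EZ, Nf, if_true, wts]
    rw [sum_mv]
    simp only [wtv_mv, Finset.sum_apply, Pi.smul_apply, Pi.sub_apply, Pi.single_apply, smul_eq_mul,
      mul_sub, mul_ite, mul_one, mul_zero, Finset.sum_sub_distrib]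
    congr 1
    · refine Finset.sum_congr rfl fun c _ => Finset.sum_congr rfl fun p _ => ?_
      simp
    · refine Finset.sum_congr rfl fun c _ => ?_
      rw [Finset.sum_comm]
      refine Finset.sum_congr rfl fun p _ => ?_
      simp
  · have : ¬ u.1 = s.1 := fun h' => h (Subtype.ext h')
    simp [EZ, Nf, this, h]

section
variable {K : Type*} [Field K]

def Ld (a b : MatVar n) : Derivation K (MvPolynomial (MatVar n) K) (MvPolynomial (MatVar n) K) :=
  (X a : MvPolynomial (MatVar n) K) • pderiv b

def ED (i j : Fin n) : Derivation K (MvPolynomial (MatVar n) K) (MvPolynomial (MatVar n) K) :=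
  ∑ c, ∑ p, Ld (mv c p i) (mv c p j) - ∑ c, ∑ q, Ld (mv c j q) (mv c i q)

lemma ED_apply (i j : Fin n) (f : MvPolynomial (MatVar n) K) : ED i j f =
    ∑ c, ∑ p, Ld (mv c p i) (mv c p j) f - ∑ c, ∑ q, Ld (mv c j q) (mv c i q) f := by
  have h : ∀ {ι : Type} (t : Finset ι) (D : ι → Derivation K (MvPolynomial (MatVar n) K)
      (MvPolynomial (MatVar n) K)), (∑ i ∈ t, D i) f = ∑ i ∈ t, D i f := by
    intro ι t D
    rw [← Derivation.coeFnAddMonoidHom_apply, map_sum, Finset.sum_apply]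
    rfl
  rw [ED, Derivation.sub_apply, h, h]
  congr 1 <;>
  · refine Finset.sum_congr rfl fun c _ => ?_
    rw [h]

lemma ED_X (i j : Fin n) (c : Bool) (p q : Fin n) :
    ED i j (X (mv c p q) : MvPolynomial (MatVar n) K) =
      (if q = j then X (mv c p i) else 0) - (if p = i then X (mv c j q) else 0) := by
  classical
  rw [ED_apply]
  simp only [Ld, Derivation.smul_apply, pderiv_X, Pi.single_apply, mv_inj, smul_eq_mul, mul_ite,
    mul_one, mul_zero]
  congr 1
  · rw [Finset.sum_eq_single c]
    · rw [Finset.sum_eq_single p]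
      · simp [eq_comm]
      · intro b _ hb; simp [Ne.symm hb]
      · simp
    · intro b _ hb; simp [Ne.symm hb]
    · simp
  · rw [Finset.sum_eq_single c]
    · rw [Finset.sum_eq_single q]
      · simp [eq_comm]
      · intro b _ hb; simp [Ne.symm hb]
      · simp
    · intro b _ hb; simp [Ne.symm hb]
    · simp

lemma ite_aux {M : Type*} [AddCommGroup M] (P1 P2 P3 P4 P5 P6 : Prop) [Decidable P1] [Decidable P2]
    [Decidable P3] [Decidable P4] [Decidable P5] [Decidable P6] (a b c d e f : M) :
    ((if P1 then (if P5 then a else 0) - (if P4 then b else 0) else 0)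
      - (if P2 then (if P3 then c else 0) - (if P6 then d else 0) else 0))
    - ((if P3 then (if P6 then e else 0) - (if P2 then c else 0) else 0)
      - (if P4 then (if P1 then b else 0) - (if P5 then f else 0) else 0))
    = (if P5 then (if P1 then a else 0) - (if P4 then f else 0) else 0)
      - (if P6 then (if P3 then e else 0) - (if P2 then d else 0) else 0) := by
  by_cases P1 <;> by_cases P2 <;> by_cases P3 <;> by_cases P4 <;> by_cases P5 <;> by_cases P6 <;>
    simp only [*, if_true, if_false] <;> abel

lemma ED_comm (i j k l : Fin n) (f : MvPolynomial (MatVar n) K) :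
    ED i j (ED k l f) - ED k l (ED i j f) =
      (if j = k then ED i l f else 0) - (if i = l then ED k j f else 0) := by
  have : ⁅ED (K := K) i j, ED (K := K) k l⁆ =
      (if j = k then ED (K := K) i l else 0) - (if i = l then ED (K := K) k j else 0) := by
    apply MvPolynomial.derivation_ext
    intro v
    obtain ⟨c, p, q, rfl⟩ := mv_surj v
    rw [Derivation.commutator_apply]
    simp only [ED_X, map_sub, apply_ite (ED (K := K) i j),
      apply_ite (ED (K := K) k l), map_zero,
      Derivation.sub_apply]
    have e1 : ((if j = k then ED (K := K) i l else 0 : Derivation K (MvPolynomial (MatVar n) K)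
      (MvPolynomial (MatVar n) K)) (X (mv c p q))) = if j = k then ED i l (X (mv c p q)) else 0 := by
      split_ifs <;> simp
    have e2 : ((if i = l then ED (K := K) k j else 0 : Derivation K (MvPolynomial (MatVar n) K)
      (MvPolynomial (MatVar n) K)) (X (mv c p q))) = if i = l then ED k j (X (mv c p q)) else 0 := by
      split_ifs <;> simp
    rw [e1, e2]
    simp only [ED_X]
    have e3 : (k = j) ↔ (j = k) := eq_comm
    have e4 : (l = i) ↔ (i = l) := eq_comm
    simp only [e3, e4]
    exact ite_aux _ _ _ _ _ _ _ _ _ _ _ _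
  have h := congrArg (fun D => D f) this
  simp only [Derivation.commutator_apply, Derivation.sub_apply] at h
  rw [h]
  congr 1 <;> split_ifs <;> simp

def Phi (k : ℕ) : (Idx n k → K) →ₗ[K] MvPolynomial (MatVar n) K :=
  Fintype.linearCombination K (fun s : Idx n k => monomial s.1 (1 : K))

lemma Phi_apply (k : ℕ) (v : Idx n k → K) : Phi k v = ∑ s, v s • monomial s.1 (1 : K) := by
  simp [Phi, Fintype.linearCombination_apply]

lemma coeff_Phi (k : ℕ) (v : Idx n k → K) (s : Idx n k) : coeff s.1 (Phi k v) = v s := by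
  classical
  rw [Phi_apply, coeff_sum, Finset.sum_eq_single s]
  · simp
  · intro b _ hb
    have : b.1 ≠ s.1 := fun h => hb (Subtype.ext h)
    simp [coeff_monomial, this]
  · simp

lemma Phi_inj (k : ℕ) : Function.Injective (Phi k : (Idx n k → K) →ₗ[K] _) := by
  intro v w h
  funext s
  rw [← coeff_Phi k v, h, coeff_Phi]

lemma mem_idx (k : ℕ) (s : MatVar n →₀ ℕ) :
    s ∈ Finset.finsuppAntidiag Finset.univ k ↔ ∑ v, s v = k := by
  simp [Finset.mem_finsuppAntidiag]

lemma Ld_monomial (k : ℕ) (a b : MatVar n) (s : Idx n k) :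
    Ld a b (monomial s.1 (1 : K)) = ∑ u : Idx n k, (Nf a b u.1 s.1 : K) • monomial u.1 (1 : K) := by
  classical
  have h0 : Ld a b (monomial s.1 (1 : K)) =
      monomial (s.1 - Finsupp.single b 1 + Finsupp.single a 1) (s.1 b : K) := by
    rw [Ld, Derivation.smul_apply, pderiv_monomial, smul_eq_mul, one_mul, add_comm, X,
      monomial_mul, one_mul]
  rw [h0]
  by_cases hb : s.1 b = 0
  · have : ∀ u : Idx n k, Nf a b u.1 s.1 = 0 := by
      intro u; simp [Nf, hb]
    simp [this, hb]
  · have hle : Finsupp.single b 1 ≤ s.1 := by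
      rw [Finsupp.single_le_iff]; omega
    have h1 : s.1 - Finsupp.single b 1 + Finsupp.single b 1 = s.1 := tsub_add_cancel_of_le hle
    have hmem : s.1 - Finsupp.single b 1 + Finsupp.single a 1 ∈
        Finset.finsuppAntidiag Finset.univ k := by
      rw [mem_idx]
      have hs := (mem_idx k s.1).1 s.2
      have h2 := congrArg (fun z : MatVar n →₀ ℕ => ∑ v, z v) h1
      simp only [Finsupp.coe_add, Pi.add_apply, Finset.sum_add_distrib, Finsupp.single_apply] at h2 ⊢
      rw [Finset.sum_ite_eq] at h2 ⊢
      simp only [Finset.mem_univ, if_true] at h2 ⊢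
      omega
    rw [Finset.sum_eq_single ⟨_, hmem⟩]
    · have : s.1 - Finsupp.single b 1 + Finsupp.single a 1 + Finsupp.single b 1 =
          s.1 + Finsupp.single a 1 := by
        rw [add_right_comm, h1]
      simp only [Nf, this, if_true, smul_monomial]
      simp
    · intro u _ hu
      have : ¬ (u.1 + Finsupp.single b 1 = s.1 + Finsupp.single a 1) := by
        intro h
        apply hu
        apply Subtype.ext
        have h3 : u.1 + Finsupp.single b 1 =
          (s.1 - Finsupp.single b 1 + Finsupp.single a 1) + Finsupp.single b 1 := by
          rw [h, add_right_comm, h1]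
        exact add_right_cancel h3
      simp [Nf, this]
    · simp

lemma sum3 {A B C M : Type*} [Fintype A] [Fintype B] [Fintype C] [AddCommMonoid M]
    (f : A → B → C → M) : ∑ a, ∑ b, ∑ c, f a b c = ∑ c, ∑ a, ∑ b, f a b c := by
  rw [Finset.sum_comm (γ := C)]
  refine Finset.sum_congr rfl fun a _ => ?_
  rw [Finset.sum_comm]

lemma ED_monomial (k : ℕ) (i j : Fin n) (s : Idx n k) :
    ED i j (monomial s.1 (1 : K)) =
      ∑ u : Idx n k, (EZ k i j u s : K) • monomial u.1 (1 : K) := by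
  rw [ED_apply]
  simp only [Ld_monomial k _ _ s, EZ, Int.cast_sub, Int.cast_sum, sub_smul, Finset.sum_smul,
    Finset.sum_sub_distrib]
  rw [← sum3 (fun c p (u : Idx n k) => (Nf (mv c p i) (mv c p j) u.1 s.1 : K) • monomial u.1 (1 : K)),
    ← sum3 (fun c q (u : Idx n k) => (Nf (mv c j q) (mv c i q) u.1 s.1 : K) • monomial u.1 (1 : K))]

lemma ED_Phi (k : ℕ) (i j : Fin n) (v : Idx n k → K) :
    ED i j (Phi k v) = Phi k ((EZ k i j).map (Int.cast : ℤ → K) *ᵥ v) := by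
  simp only [Phi_apply, map_sum, Derivation.map_smul, ED_monomial, Matrix.mulVec, dotProduct,
    Finset.smul_sum, Finset.sum_smul, Matrix.map_apply]
  rw [Finset.sum_comm]
  refine Finset.sum_congr rfl fun s _ => Finset.sum_congr rfl fun u _ => ?_
  rw [smul_smul, mul_comm]
end

lemma EZ_comm (m : ℕ) (i j k l : Fin n) : EZ m i j * EZ m k l - EZ m k l * EZ m i j =
      (if j = k then EZ m i l else 0) - (if i = l then EZ m k j else 0) := by
  have inj : Function.Injective ((Int.castRingHom ℚ).mapMatrix (m := Idx n m)) := by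
    intro A B h
    ext u s
    have := congrFun (congrFun h u) s
    simpa using this
  apply inj
  simp only [map_sub, map_mul, apply_ite (Int.castRingHom ℚ).mapMatrix, map_zero]
  apply Matrix.ext_of_mulVec_single
  intro s
  apply Phi_inj m
  have key := ED_comm (K := ℚ) i j k l (Phi m (Pi.single s 1))
  simp only [ED_Phi] at key
  have c : ∀ (P : Prop) [Decidable P] (A : Matrix (Idx n m) (Idx n m) ℚ) (v : Idx n m → ℚ),
    Phi m ((if P then A else 0) *ᵥ v) = if P then Phi m (A *ᵥ v) else 0 := by
    intro P _ A v; split_ifs <;> simp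
  simp only [Matrix.sub_mulVec, map_sub, ← Matrix.mulVec_mulVec, c]
  exact key
end LPn

namespace LPn
variable {n : ℕ} {K : Type*} [Field K]

lemma pairSub_mv (A B : Matrix (Fin n) (Fin n) K) (c : Bool) (p q : Fin n) :
    pairSub A B (mv c p q) = if c then A p q else B p q := by
  cases c <;> rfl

/-- entry of the conjugate by a transvection -/
def wpol {R : Type*} [CommRing R] (i j : Fin n) (c : R) (A : Matrix (Fin n) (Fin n) R) :
    Matrix (Fin n) (Fin n) R := fun p q =>
  A p q + (if p = i then c * A j q else 0)
    - (if q = j then c * (A p i + (if p = i then c * A j i else 0)) else 0)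

lemma wpol_eq {i j : Fin n} (_ : i ≠ j) (c : K) (A : Matrix (Fin n) (Fin n) K) :
    transvection i j c * A * transvection i j (-c) = wpol i j c A := by
  ext p q
  have hM : ∀ p q, (transvection i j c * A) p q = A p q + (if p = i then c * A j q else 0) := by
    intro p q
    by_cases hp : p = i
    · subst hp
      rw [transvection_mul_apply_same]; simp
    · rw [transvection_mul_apply_of_ne _ _ _ _ hp]; simp [hp]
  by_cases hq : q = j
  · subst hq
    rw [mul_transvection_apply_same, hM, hM]
    simp only [wpol, if_true]; ring
  · rw [mul_transvection_apply_of_ne _ _ _ _ hq, hM]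
    simp [wpol, hq]

def psi (i j : Fin n) (A B : Matrix (Fin n) (Fin n) K) :
    MvPolynomial (MatVar n) K →ₐ[K] Polynomial K :=
  aeval (pairSub (wpol i j Polynomial.X (A.map Polynomial.C))
    (wpol i j Polynomial.X (B.map Polynomial.C)))

lemma psi_eval (i j : Fin n) (A B : Matrix (Fin n) (Fin n) K) (f : MvPolynomial (MatVar n) K)
    (c : K) : (psi i j A B f).eval c = eval (pairSub (wpol i j c A) (wpol i j c B)) f := by
  induction f using MvPolynomial.induction_on with
  | C a => simp [psi]
  | add p q hp hq => rw [map_add, Polynomial.eval_add, hp, hq, map_add]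
  | mul_X p v hp =>
    rw [map_mul, Polynomial.eval_mul, hp, map_mul]
    congr 1
    rcases v with ⟨p, q⟩ | ⟨p, q⟩ <;> simp [psi, pairSub, wpol, apply_ite (Polynomial.eval c), mul_comm c]

lemma psi_X {i j : Fin n} (A B : Matrix (Fin n) (Fin n) K) (c : Bool) (p q : Fin n) :
    psi i j A B (X (mv c p q)) = wpol i j Polynomial.X ((if c then A else B).map Polynomial.C) p q := by
  cases c <;> simp [psi, pairSub, mv]

lemma psi_deriv {i j : Fin n} (hij : i ≠ j) (A B : Matrix (Fin n) (Fin n) K)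
    (f : MvPolynomial (MatVar n) K) :
    Polynomial.derivative (psi i j A B f) = - psi i j A B (ED i j f) := by
  induction f using MvPolynomial.induction_on with
  | C a =>
    rw [show (C a : MvPolynomial (MatVar n) K) = algebraMap K _ a from rfl, Derivation.map_algebraMap,
      AlgHom.commutes]
    simp
  | add p q hp hq => rw [map_add, map_add, hp, hq, map_add, map_add]; ring
  | mul_X p v hp =>
    rw [map_mul, Polynomial.derivative_mul, hp, Derivation.leibniz]
    have hv : Polynomial.derivative (psi i j A B (X v)) = - psi i j A B (ED i j (X v)) := by
      obtain ⟨c, a, b, rfl⟩ := mv_surj v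
      rw [ED_X, map_sub, apply_ite (psi i j A B), apply_ite (psi i j A B)]
      simp only [psi_X, map_zero]
      generalize (if c then A else B) = M
      simp only [wpol, Matrix.map_apply]
      by_cases h1 : a = i <;> by_cases h2 : b = j <;>
        simp [h1, h2, hij, hij.symm] <;> ring
    rw [hv]
    simp only [smul_eq_mul, map_add, map_mul]
    ring

lemma conj_transv {i j : Fin n} (hij : i ≠ j) (c : K) (A : Matrix (Fin n) (Fin n) K) :
    transvection i j c * A * (transvection i j c)⁻¹ = wpol i j c A := by
  rw [← wpol_eq hij]
  congr 1
  apply Matrix.inv_eq_right_inv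
  rw [transvection_mul_transvection_same _ _ hij]
  simp

lemma eval_pairSub_funext [Infinite K] (f : MvPolynomial (MatVar n) K)
    (h : ∀ A B : Matrix (Fin n) (Fin n) K, eval (pairSub A B) f = 0) : f = 0 := by
  apply MvPolynomial.funext
  intro x
  rw [map_zero]
  have := h (fun p q => x (Sum.inl (p, q))) (fun p q => x (Sum.inr (p, q)))
  rw [← this]
  congr 2
  funext v
  rcases v with ⟨p, q⟩ | ⟨p, q⟩ <;> rfl

lemma wpol_zero (i j : Fin n) (A : Matrix (Fin n) (Fin n) K) : wpol i j 0 A = A := by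
  ext p q; simp [wpol]

lemma sum_ED (f : MvPolynomial (MatVar n) K) : ∑ i, ED i i f = 0 := by
  have h : (∑ i, ED i i : Derivation K (MvPolynomial (MatVar n) K) (MvPolynomial (MatVar n) K)) = 0 := by
    apply MvPolynomial.derivation_ext
    intro v
    obtain ⟨c, p, q, rfl⟩ := mv_surj v
    rw [← Derivation.coeFnAddMonoidHom_apply, map_sum, Finset.sum_apply]
    simp only [Derivation.coeFnAddMonoidHom_apply, ED_X, Finset.sum_sub_distrib]
    simp
  have := congrArg (fun D => D f) h
  simp only [Derivation.zero_apply] at this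
  rw [← Derivation.coeFnAddMonoidHom_apply, map_sum, Finset.sum_apply] at this
  exact this

lemma inv_killed [CharZero K] (f : MvPolynomial (MatVar n) K) (hf : IsMatInvariant f) (i j : Fin n) :
    ED i j f = 0 := by
  have h1 : ∀ i j : Fin n, i ≠ j → ED i j f = 0 := by
    intro i j hij
    apply eval_pairSub_funext
    intro A B
    have hc : psi i j A B f = Polynomial.C (eval (pairSub A B) f) := by
      apply Polynomial.funext
      intro c
      rw [psi_eval, Polynomial.eval_C]
      have hdet : IsUnit (transvection i j c).det := by
        rw [det_transvection_of_ne _ _ hij]; exact isUnit_one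
      have := hf ((transvection i j c).nonsingInvUnit hdet) A B
      rw [Matrix.coe_units_inv] at this
      have hco : (((transvection i j c).nonsingInvUnit hdet : GL (Fin n) K) :
        Matrix (Fin n) (Fin n) K) = transvection i j c := rfl
      rw [hco, conj_transv hij, conj_transv hij] at this
      exact this
    have hd := psi_deriv hij A B f
    rw [hc, Polynomial.derivative_C] at hd
    have := congrArg (Polynomial.eval 0) hd
    rw [Polynomial.eval_neg, psi_eval, wpol_zero, wpol_zero] at this
    simpa using this
  by_cases hij : i = j
  · subst hij
    have h2 : ∀ k, ED k k f = ED i i f := by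
      intro k
      by_cases hk : k = i
      · rw [hk]
      · have := ED_comm k i i k f
        rw [h1 k i hk, h1 i k (Ne.symm hk)] at this
        simp only [map_zero, sub_zero, if_true] at this
        exact (sub_eq_zero.1 this.symm)
    have h3 := sum_ED f
    simp only [h2, Finset.sum_const, Finset.card_univ, Fintype.card_fin] at h3
    have hn : n ≠ 0 := by rintro rfl; exact i.elim0
    rw [smul_eq_zero] at h3
    exact h3.resolve_left hn
  · exact h1 i j hij

lemma ED_diag_coeff [CharZero K] (f : MvPolynomial (MatVar n) K) (k : ℕ) (v : Idx n k → K)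
    (hv : f = Phi k v) (h : ∀ i, ED i i f = 0) (s : Idx n k) (hs : v s ≠ 0) : wts s.1 = 0 := by
  funext i
  have h1 := h i
  rw [hv, ED_Phi, EZ_diag] at h1
  have h2 := Phi_inj k (h1.trans (map_zero (Phi k)).symm)
  have h3 := congrFun h2 s
  rw [Matrix.diagonal_map (by simp), Matrix.mulVec_diagonal] at h3
  simpa [hs] using h3

lemma diag_inv [CharZero K] (f : MvPolynomial (MatVar n) K) (k : ℕ) (v : Idx n k → K)
    (hv : f = Phi k v) (h : ∀ i, ED i i f = 0) (d : Fin n → K) (hd : ∀ i, d i ≠ 0)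
    (A B : Matrix (Fin n) (Fin n) K) :
    eval (pairSub (diagonal d * A * (diagonal d)⁻¹) (diagonal d * B * (diagonal d)⁻¹)) f =
      eval (pairSub A B) f := by
  have hinv : (diagonal d)⁻¹ = diagonal (fun i => (d i)⁻¹) := by
    apply Matrix.inv_eq_right_inv
    rw [diagonal_mul_diagonal, ← diagonal_one]
    congr 1; funext i; exact mul_inv_cancel₀ (hd i)
  have hps : ∀ w, pairSub (diagonal d * A * (diagonal d)⁻¹) (diagonal d * B * (diagonal d)⁻¹) w
      = (∏ i, d i ^ (-(wtv w i))) * pairSub A B w := by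
    intro w
    obtain ⟨c, p, q, rfl⟩ := mv_surj w
    have hpr : ∏ i, d i ^ (-(wtv (mv c p q) i)) = d p * (d q)⁻¹ := by
      rw [wtv_mv]
      have : ∀ i, d i ^ (-((Pi.single q 1 - Pi.single p 1 : Fin n → ℤ) i)) =
          (if i = p then d i else 1) * (if i = q then (d i)⁻¹ else 1) := by
        intro i
        have hi := hd i
        by_cases h1 : i = p <;> by_cases h2 : i = q <;>
          simp_all [Pi.single_apply]
      simp only [this, Finset.prod_mul_distrib]
      simp
    rw [hpr, pairSub_mv, pairSub_mv, hinv]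
    cases c <;> simp [diagonal_mul, mul_diagonal] <;> ring
  rw [hv, Phi_apply, map_sum, map_sum]
  refine Finset.sum_congr rfl fun s _ => ?_
  rw [smul_eval, smul_eval]
  by_cases hs : v s = 0
  · simp [hs]
  · have hw := ED_diag_coeff f k v hv h s hs
    refine congrArg (fun z => v s * z) ?_
    rw [eval_monomial, eval_monomial]
    rw [Finsupp.prod_fintype _ _ (by simp), Finsupp.prod_fintype _ _ (by simp)]
    refine congrArg (fun z => 1 * z) ?_
    simp only [hps, mul_pow, Finset.prod_mul_distrib]
    have : ∏ w, (∏ i, d i ^ (-(wtv w i))) ^ (s.1 w) = 1 := by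
      simp only [← Finset.prod_pow]
      rw [Finset.prod_comm]
      refine Finset.prod_eq_one fun i _ => ?_
      have h0 : ∏ w, (d i ^ (-(wtv w i))) ^ (s.1 w) = d i ^ (- (wts s.1 i)) := by
        rw [wts, Finset.sum_apply, ← Finset.sum_neg_distrib]
        have : ∀ (t : Finset (MatVar n)) (g : MatVar n → ℤ), d i ^ (∑ w ∈ t, g w) = ∏ w ∈ t, d i ^ g w := by
          intro t g
          induction t using Finset.induction_on with
          | empty => simp
          | insert a t ha ih => rw [Finset.sum_insert ha, Finset.prod_insert ha, zpow_add₀ (hd i), ih]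
        rw [this]
        refine Finset.prod_congr rfl fun w _ => ?_
        rw [← zpow_natCast, ← _root_.zpow_mul]
        congr 1
        simp; ring
      rw [h0, hw]; simp
    rw [this, one_mul]

lemma killed_inv [CharZero K] (f : MvPolynomial (MatVar n) K) (k : ℕ) (v : Idx n k → K)
    (hv : f = Phi k v) (h : ∀ i j, ED i j f = 0) : IsMatInvariant f := by
  have key : ∀ M : Matrix (Fin n) (Fin n) K, M.det ≠ 0 → ∀ A B,
      eval (pairSub (M * A * M⁻¹) (M * B * M⁻¹)) f = eval (pairSub A B) f := by
    intro M hM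
    refine Matrix.diagonal_transvection_induction_of_det_ne_zero
      (fun M => ∀ A B, eval (pairSub (M * A * M⁻¹) (M * B * M⁻¹)) f = eval (pairSub A B) f) M hM
      ?_ ?_ ?_
    · intro D hD A B
      apply diag_inv f k v hv (fun i => h i i)
      intro i hi
      apply hD
      rw [det_diagonal]
      exact Finset.prod_eq_zero (Finset.mem_univ i) hi
    · rintro ⟨i, j, hij, c⟩ A B
      simp only [TransvectionStruct.toMatrix_mk]
      rw [conj_transv hij, conj_transv hij, ← psi_eval]
      have hd := psi_deriv hij A B f
      rw [h, map_zero, neg_zero] at hd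
      have h2 := Polynomial.eq_C_of_derivative_eq_zero hd
      have h3 : (psi i j A B f).eval c = (psi i j A B f).eval 0 := by
        rw [h2]; simp
      rw [h3, psi_eval, wpol_zero, wpol_zero]
    · intro M N _ _ h1 h2 A B
      rw [Matrix.mul_inv_rev]
      have := h1 (N * A * N⁻¹) (N * B * N⁻¹)
      rw [h2] at this
      rw [← this]
      simp only [mul_assoc]
  intro a A B
  rw [Matrix.coe_units_inv]
  apply key
  exact ((Matrix.isUnit_iff_isUnit_det _).1 a.isUnit).ne_zero

def Vk (K : Type*) [Field K] (n k : ℕ) : Submodule K (Idx n k → K) where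
  carrier := {v | ∀ i j, (EZ k i j).map (Int.cast : ℤ → K) *ᵥ v = 0}
  add_mem' := by
    intro a b ha hb i j
    rw [Matrix.mulVec_add, ha, hb, add_zero]
  zero_mem' := by intro i j; simp
  smul_mem' := by
    intro c a ha i j
    rw [Matrix.mulVec_smul, ha, smul_zero]

lemma homog_Phi (k : ℕ) (v : Idx n k → K) : (Phi k v).IsHomogeneous k := by
  rw [Phi_apply]
  refine IsHomogeneous.sum _ _ _ (fun s _ => ?_)
  have hs : s.1.degree = k := by
    rw [Finsupp.degree_eq_sum]
    exact (mem_idx k s.1).1 s.2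
  have := isHomogeneous_monomial (R := K) (v s) hs
  rw [smul_monomial, smul_eq_mul, mul_one]
  exact this

lemma exists_Phi (k : ℕ) (f : MvPolynomial (MatVar n) K) (hf : f.IsHomogeneous k) :
    ∃ v, f = Phi k v := by
  refine ⟨fun s => coeff s.1 f, ?_⟩
  apply MvPolynomial.ext
  intro s
  by_cases hs : s ∈ Finset.finsuppAntidiag Finset.univ k
  · exact (coeff_Phi (K := K) k (fun s => coeff s.1 f) ⟨s, hs⟩).symm
  · have hd : s.degree ≠ k := by
      intro h; apply hs; rw [mem_idx, ← h, Finsupp.degree_eq_sum]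
    rw [hf.coeff_eq_zero hd, (homog_Phi (K := K) k _).coeff_eq_zero hd]

lemma pureDim_eq [CharZero K] (k : ℕ) : pureDim1 K n k = Module.finrank K (Vk K n k) := by
  have : pureComponent1 K n k = ((Vk K n k).map (Phi k) : Set (MvPolynomial (MatVar n) K)) := by
    ext f
    simp only [pureComponent1, Set.mem_ofPred_eq, Submodule.map_coe, Set.mem_image, SetLike.mem_coe]
    constructor
    · rintro ⟨h1, h2⟩
      obtain ⟨v, hv⟩ := exists_Phi k f h2
      refine ⟨v, ?_, hv.symm⟩
      intro i j
      apply Phi_inj k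
      rw [← ED_Phi, ← hv, map_zero]
      exact inv_killed f h1 i j
    · rintro ⟨v, hv, rfl⟩
      refine ⟨?_, homog_Phi k v⟩
      apply killed_inv _ k v rfl
      intro i j
      rw [ED_Phi, hv i j, map_zero]
  rw [pureDim1, Set.finrank, this, Submodule.span_eq]
  exact (Submodule.equivMapOfInjective (Phi k) (Phi_inj k) (Vk K n k)).finrank_eq.symm

theorem mol3 [CharZero K] (k : ℕ) :
    ct (van3 xv * van3 yv * ch (fun s : Idx 3 k => wts s.1) (1 : Matrix (Idx 3 k) (Idx 3 k) K)) =
      (pureDim1 K 3 k : K) * ct (van3 (K := K) xv * van3 yv) := by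
  rw [pureDim_eq]
  refine mol_abstract (fun s : Idx 3 k => wts s.1) (EZ k) (fun s => fct s.1) (fun s => fct_pos _)
    (EZ_adj k) (EZ_diag k) (EZ_comm k) _ ?_ (Vk K 3 k) (fun v => Iff.rfl)
  intro A hA
  refine weyl3 _ (fun i j => (EZ k i j).map (Int.cast : ℤ → K)) A ?_ ?_ ?_ hA (fun s => wts_sum _)
  · intro i
    simp only [EZ_diag]
    rw [Matrix.diagonal_map (by simp)]
  · intro i j u s h
    apply EZ_wt k i j u s
    intro h0; apply h; simp [h0]
  · intro i j
    have := congrArg (Int.castRingHom K).mapMatrix (EZ_comm k i j j i)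
    simp only [map_sub, map_mul, if_true] at this
    exact this

theorem mol4 [CharZero K] (k : ℕ) :
    ct (van4 xv * van4 yv * ch (fun s : Idx 4 k => wts s.1) (1 : Matrix (Idx 4 k) (Idx 4 k) K)) =
      (pureDim1 K 4 k : K) * ct (van4 (K := K) xv * van4 yv) := by
  rw [pureDim_eq]
  refine mol_abstract (fun s : Idx 4 k => wts s.1) (EZ k) (fun s => fct s.1) (fun s => fct_pos _)
    (EZ_adj k) (EZ_diag k) (EZ_comm k) _ ?_ (Vk K 4 k) (fun v => Iff.rfl)
  intro A hA
  refine weyl4 _ (fun i j => (EZ k i j).map (Int.cast : ℤ → K)) A ?_ ?_ ?_ hA (fun s => wts_sum _)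
  · intro i
    simp only [EZ_diag]
    rw [Matrix.diagonal_map (by simp)]
  · intro i j u s h
    apply EZ_wt k i j u s
    intro h0; apply h; simp [h0]
  · intro i j
    have := congrArg (Int.castRingHom K).mapMatrix (EZ_comm k i j j i)
    simp only [map_sub, map_mul, if_true] at this
    exact this
end LPn

namespace LPn

abbrev RR (K : Type*) [Field K] (n : ℕ) := PowerSeries (LP K n)

variable {K : Type*} [Field K] {n : ℕ}

def iot : PowerSeries K →+* RR K n := PowerSeries.map (algebraMap K (LP K n))

def CT : RR K n →+ PowerSeries K where
  toFun f := PowerSeries.mk fun k => ct (PowerSeries.coeff k f)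
  map_zero' := by ext k; simp
  map_add' f g := by ext k; simp

lemma coeff_CT (k : ℕ) (f : RR K n) :
    PowerSeries.coeff k (CT f) = ct (PowerSeries.coeff k f) := by
  simp [CT]

lemma ct_alg_mul (a : K) (f : LP K n) : ct (algebraMap K (LP K n) a * f) = a * ct f := by
  rw [← Algebra.smul_def, map_smul, smul_eq_mul]

lemma CT_iot_mul (s : PowerSeries K) (f : RR K n) : CT (iot s * f) = s * CT f := by
  ext k
  rw [coeff_CT, PowerSeries.coeff_mul, PowerSeries.coeff_mul, map_sum]
  refine Finset.sum_congr rfl fun p _ => ?_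
  rw [coeff_CT, iot, PowerSeries.coeff_map, ct_alg_mul]

lemma ct_one : ct (1 : LP K n) = 1 := by
  rw [← mon_zero, mon, ct_single]; simp

lemma CT_one : CT (1 : RR K n) = 1 := by
  ext k
  rw [coeff_CT, PowerSeries.coeff_one, PowerSeries.coeff_one]
  split_ifs <;> simp [ct_one]

lemma CT_iot (s : PowerSeries K) : CT (iot s : RR K n) = s := by
  have := CT_iot_mul (n := n) s 1
  rwa [mul_one, CT_one, mul_one] at this

lemma iot_X : (iot PowerSeries.X : RR K n) = PowerSeries.X := by simp [iot]

/-- geometric series -/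
def gi {R : Type*} [CommRing R] (a : PowerSeries R) : PowerSeries R :=
  PowerSeries.invOfUnit (1 - PowerSeries.X * a) 1

lemma gi_mul {R : Type*} [CommRing R] (a : PowerSeries R) :
    (1 - PowerSeries.X * a) * gi a = 1 :=
  PowerSeries.mul_invOfUnit _ _ (by simp)

lemma gi_unique {R : Type*} [CommRing R] {a b : PowerSeries R}
    (h : (1 - PowerSeries.X * a) * b = 1) : b = gi a := by
  linear_combination (gi a) * h - b * gi_mul a

lemma gi_eq {R : Type*} [CommRing R] (a : PowerSeries R) :
    gi a = 1 + PowerSeries.X * (a * gi a) := by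
  linear_combination gi_mul a

lemma map_gi {R S : Type*} [CommRing R] [CommRing S] (f : PowerSeries R →+* PowerSeries S)
    (hf : f PowerSeries.X = PowerSeries.X) (a : PowerSeries R) : f (gi a) = gi (f a) := by
  apply gi_unique
  rw [← hf, ← map_mul, ← map_one f, ← map_sub, ← map_mul, gi_mul]

/-- support in a half space -/
def PosL (l : (Fin n → ℤ) →+ ℤ) : Subring (LP K n) where
  carrier := {f | ∀ v, f.coeff v ≠ 0 → 0 ≤ l v}
  mul_mem' := by
    intro f g hf hg v hv
    have h1 := AddMonoidAlgebra.support_coeff_mul_subset (x := f) (y := g) (Finsupp.mem_support_iff.2 hv)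
    rw [Finset.mem_add] at h1
    obtain ⟨a, ha, b, hb, rfl⟩ := h1
    have := hf a (Finsupp.mem_support_iff.1 ha)
    have := hg b (Finsupp.mem_support_iff.1 hb)
    rw [map_add]; omega
  one_mem' := by
    intro v hv
    by_cases h : v = 0
    · simp [h]
    · exfalso; apply hv
      change (Finsupp.single 0 1 : (Fin n → ℤ) →₀ K) v = 0
      rw [Finsupp.single_apply, if_neg (Ne.symm h)]
  add_mem' := by
    intro f g hf hg v hv
    by_cases h : f.coeff v = 0
    · apply hg v; intro h2; apply hv; simp [h, h2]
    · exact hf v h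
  zero_mem' := by intro v hv; simp at hv
  neg_mem' := by intro f hf v hv; apply hf v; simpa using hv

lemma mon_memL (l : (Fin n → ℤ) →+ ℤ) (e : Fin n → ℤ) (he : 0 ≤ l e) : (mon e : LP K n) ∈ PosL l := by
  intro v hv
  have : e = v := by
    by_contra h
    apply hv
    change (Finsupp.single e 1 : (Fin n → ℤ) →₀ K) v = 0
    rw [Finsupp.single_apply, if_neg h]
  rwa [← this]

lemma ct_mon_mul_zero (l : (Fin n → ℤ) →+ ℤ) (e : Fin n → ℤ) (he : 0 < l e) (h : LP K n)
    (hh : h ∈ PosL l) : ct (mon e * h) = 0 := by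
  by_contra hne
  have h1 := AddMonoidAlgebra.support_coeff_mul_subset (x := mon e) (y := h)
    ((Finsupp.mem_support_iff (a := (0 : Fin n → ℤ))).2 hne)
  rw [Finset.mem_add] at h1
  obtain ⟨a, ha, b, hb, hab⟩ := h1
  have h2 := hh b (Finsupp.mem_support_iff.1 hb)
  have h3 : e = a := by
    by_contra h
    apply Finsupp.mem_support_iff.1 ha
    change (Finsupp.single e 1 : (Fin n → ℤ) →₀ K) a = 0
    rw [Finsupp.single_apply, if_neg h]
  have := congrArg l hab
  rw [map_add, map_zero, ← h3] at this
  omega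

def Pos (l : (Fin n → ℤ) →+ ℤ) : Subring (RR K n) where
  carrier := {f | ∀ k, PowerSeries.coeff k f ∈ PosL l}
  mul_mem' := by
    intro f g hf hg k
    rw [PowerSeries.coeff_mul]
    exact sum_mem fun p _ => mul_mem (hf _) (hg _)
  one_mem' := by
    intro k
    rw [PowerSeries.coeff_one]
    split_ifs
    · exact one_mem _
    · exact zero_mem _
  add_mem' := by intro f g hf hg k; rw [map_add]; exact add_mem (hf k) (hg k)
  zero_mem' := by intro k; rw [map_zero]; exact zero_mem _
  neg_mem' := by intro f hf k; rw [map_neg]; exact neg_mem (hf k)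

variable {l : (Fin n → ℤ) →+ ℤ}

lemma X_mem : (PowerSeries.X : RR K n) ∈ Pos l := by
  intro k
  rw [PowerSeries.coeff_X]
  split_ifs
  · exact one_mem _
  · exact zero_mem _

lemma C_mem {f : LP K n} (hf : f ∈ PosL l) : (PowerSeries.C f : RR K n) ∈ Pos l := by
  intro k
  rw [PowerSeries.coeff_C]
  split_ifs
  · exact hf
  · exact zero_mem _

lemma iot_mem (s : PowerSeries K) : (iot s : RR K n) ∈ Pos l := by
  intro k
  rw [iot, PowerSeries.coeff_map, Algebra.algebraMap_eq_smul_one, ← mon_zero, ← single_eq]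
  intro v hv
  have : 0 = v := by
    by_contra h
    apply hv
    change (Finsupp.single 0 _ : (Fin n → ℤ) →₀ K) v = 0
    rw [Finsupp.single_apply, if_neg h]
  rw [← this, map_zero]

lemma gi_mem {a : RR K n} (ha : a ∈ Pos l) : gi a ∈ Pos l := by
  intro k
  induction k using Nat.strong_induction_on with
  | _ k ih =>
    rw [gi_eq, map_add]
    refine add_mem ((one_mem (Pos l) : (1 : RR K n) ∈ Pos l) k) ?_
    cases k with
    | zero => rw [PowerSeries.coeff_zero_X_mul]; exact zero_mem _
    | succ k =>
      rw [PowerSeries.coeff_succ_X_mul, PowerSeries.coeff_mul]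
      refine sum_mem fun p hp => mul_mem (ha _) (ih _ ?_)
      have := Finset.HasAntidiagonal.mem_antidiagonal.1 hp
      omega

/-- monomials -/
def mo (e : Fin n → ℤ) : RR K n := PowerSeries.C (mon e)

lemma mo_mul (e f : Fin n → ℤ) : (mo e * mo f : RR K n) = mo (e + f) := by
  rw [mo, mo, mo, ← map_mul, mon_mul]

lemma mo_zero : (mo 0 : RR K n) = 1 := by rw [mo, mon_zero, map_one]

lemma mo_mem (e : Fin n → ℤ) (he : 0 ≤ l e) : (mo e : RR K n) ∈ Pos l := C_mem (mon_memL l e he)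

lemma CT_mo_mul_zero (e : Fin n → ℤ) (he : 0 < l e) {h : RR K n}
    (hh : h ∈ Pos l) : CT (mo e * h) = 0 := by
  ext k
  rw [coeff_CT, mo, PowerSeries.coeff_C_mul, ct_mon_mul_zero l e he _ (hh k), map_zero]

def D0 (l : (Fin n → ℤ) →+ ℤ) : Subring (RR K n) := Pos l ⊓ Pos (-l)

lemma D0_pos {f : RR K n} (h : f ∈ D0 l) : f ∈ Pos l := h.1
lemma D0_neg {f : RR K n} (h : f ∈ D0 l) : f ∈ Pos (-l) := h.2
lemma X_mem0 : (PowerSeries.X : RR K n) ∈ D0 l := ⟨X_mem, X_mem⟩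
lemma iot_mem0 (s : PowerSeries K) : (iot s : RR K n) ∈ D0 l := ⟨iot_mem s, iot_mem s⟩
lemma gi_mem0 {a : RR K n} (ha : a ∈ D0 l) : gi a ∈ D0 l := ⟨gi_mem ha.1, gi_mem ha.2⟩
lemma mo_mem0 (e : Fin n → ℤ) (he : l e = 0) : (mo e : RR K n) ∈ D0 l :=
  ⟨mo_mem e (by omega), mo_mem e (by simp [he])⟩

/-- first order congruence -/
def R1 (l : (Fin n → ℤ) →+ ℤ) (d f f0 : RR K n) : Prop :=
  f0 ∈ D0 l ∧ ∃ h ∈ Pos l, f = f0 + d * h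

def R2 (l : (Fin n → ℤ) →+ ℤ) (d f f0 f1 : RR K n) : Prop :=
  f0 ∈ D0 l ∧ f1 ∈ D0 l ∧ ∃ h ∈ Pos l, f = f0 + d * f1 + d ^ 2 * h

theorem lemA (e : Fin n → ℤ) (he : l e = 1) {c f f0 : RR K n} (hc : c ∈ D0 l)
    (hf : R1 l (mo e - PowerSeries.X * c) f f0) :
    CT (f * gi (c * mo (-e))) = CT f0 := by
  obtain ⟨h0, h, hh, rfl⟩ := hf
  have hw : (mo e * mo (-e) : RR K n) = 1 := by rw [mo_mul, add_neg_cancel, mo_zero]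
  have h1 := gi_mul (c * mo (-e))
  have hg : gi (c * mo (-e)) ∈ Pos (-l) :=
    gi_mem (mul_mem hc.2 (mo_mem _ (by simp [he])))
  have key : (f0 + (mo e - PowerSeries.X * c) * h) * gi (c * mo (-e)) =
      f0 + mo (-e) * (PowerSeries.X * c * f0 * gi (c * mo (-e))) + mo e * h := by
    linear_combination (f0 + mo e * h) * h1 +
      PowerSeries.X * c * h * gi (c * mo (-e)) * hw
  rw [key, map_add, map_add, CT_mo_mul_zero (l := l) e (by omega) hh,
    CT_mo_mul_zero (l := -l) (-e) (by simp [he]), add_zero, add_zero]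
  exact mul_mem (mul_mem (mul_mem X_mem hc.2) h0.2) hg

theorem lemB (e : Fin n → ℤ) (he : l e = 1) {c f f0 f1 : RR K n} (hc : c ∈ D0 l)
    (hf : R2 l (mo e - PowerSeries.X * c) f f0 f1) :
    CT (f * gi (c * mo (-e)) ^ 2) = CT (f0 + PowerSeries.X * c * f1) := by
  obtain ⟨h0, h1, h, hh, rfl⟩ := hf
  have hw : (mo e * mo (-e) : RR K n) = 1 := by rw [mo_mul, add_neg_cancel, mo_zero]
  have hgi := gi_mul (c * mo (-e))
  have hg : gi (c * mo (-e)) ∈ Pos (-l) :=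
    gi_mem (mul_mem hc.2 (mo_mem _ (by simp [he])))
  set g := gi (c * mo (-e)) with hgdef
  set w : RR K n := mo e with hwd
  set w' : RR K n := mo (-e) with hwd'
  set X : RR K n := PowerSeries.X
  have e1 : (w - X * c) * g = w := by
    linear_combination w * hgi + X * c * g * hw
  have e2 : g = 1 + w' * (X * c * g) := by linear_combination hgi
  have e3 : g ^ 2 = 1 + w' * (X * c * g * (1 + g)) := by linear_combination (1 + g) * hgi
  have e4 : w * g = w + X * c + w' * (X * c * (X * c * g)) := by
    linear_combination w * hgi + X * c * g * hw + X * c * hgi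
  have key : (f0 + (w - X * c) * f1 + (w - X * c) ^ 2 * h) * g ^ 2 =
      (f0 + X * c * f1) + w' * (X * c * g * (1 + g) * f0 + X * c * (X * c * g) * f1) +
        w * (f1 + w * h) := by
    calc _ = f0 * g ^ 2 + ((w - X * c) * g) * g * f1 + ((w - X * c) * g) ^ 2 * h := by ring
      _ = f0 * g ^ 2 + (w * g) * f1 + w ^ 2 * h := by rw [e1]
      _ = _ := by rw [e3, e4]; ring
  have hX : X ∈ Pos (-l) := X_mem
  rw [key, map_add CT _ (w * _), map_add CT _ (w' * _), hwd, hwd',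
    CT_mo_mul_zero (l := l) e (by omega) (add_mem h1.1 (mul_mem (mo_mem e (by omega)) hh)),
    CT_mo_mul_zero (l := -l) (-e) (by simp [he]), add_zero, add_zero]
  have hXc := mul_mem hX hc.2
  have hXcg := mul_mem hXc hg
  exact add_mem (mul_mem (mul_mem hXcg (add_mem (one_mem _) hg)) h0.2)
    (mul_mem (mul_mem hXc hXcg) h1.2)

section cong
variable {d : RR K n}
lemma R1.const {f : RR K n} (hf : f ∈ D0 l) : R1 l d f f := ⟨hf, 0, zero_mem _, by ring⟩
lemma R1.mul (hd : d ∈ Pos l) {f f0 g g0 : RR K n} (hf : R1 l d f f0) (hg : R1 l d g g0) :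
    R1 l d (f * g) (f0 * g0) := by
  obtain ⟨h0, h, hh, rfl⟩ := hf
  obtain ⟨k0, k, hk, rfl⟩ := hg
  exact ⟨mul_mem h0 k0, f0 * k + h * g0 + d * h * k, add_mem (add_mem (mul_mem h0.1 hk) (mul_mem hh k0.1))
    (mul_mem (mul_mem hd hh) hk), by ring⟩
lemma R1.pow (hd : d ∈ Pos l) {f f0 : RR K n} (hf : R1 l d f f0) (k : ℕ) : R1 l d (f ^ k) (f0 ^ k) := by
  induction k with
  | zero => simpa using R1.const (one_mem _)
  | succ k ih => rw [pow_succ, pow_succ]; exact R1.mul hd ih hf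
lemma R1.lin {a b w c : RR K n} (ha : a ∈ D0 l) (hb : b ∈ D0 l) (hc : c ∈ D0 l) :
    R1 l (w - c) (a + b * w) (a + b * c) :=
  ⟨add_mem ha (mul_mem hb hc), b, hb.1, by ring⟩
lemma R1.gi {b w c : RR K n} (hb : b ∈ D0 l) (hc : c ∈ D0 l) (hw : w ∈ Pos l) :
    R1 l (w - c) (gi (b * w)) (gi (b * c)) := by
  refine ⟨gi_mem0 (mul_mem hb hc), PowerSeries.X * b * LPn.gi (b * w) * LPn.gi (b * c),
    mul_mem (mul_mem (mul_mem X_mem hb.1) (gi_mem (mul_mem hb.1 hw))) (gi_mem (mul_mem hb.1 hc.1)), ?_⟩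
  linear_combination LPn.gi (b * c) * gi_mul (b * w) - LPn.gi (b * w) * gi_mul (b * c)
lemma R2.const {f : RR K n} (hf : f ∈ D0 l) : R2 l d f f 0 :=
  ⟨hf, zero_mem _, 0, zero_mem _, by ring⟩
lemma R2.mul (hd : d ∈ Pos l) {f f0 f1 g g0 g1 : RR K n} (hf : R2 l d f f0 f1) (hg : R2 l d g g0 g1) :
    R2 l d (f * g) (f0 * g0) (f0 * g1 + f1 * g0) := by
  obtain ⟨h0, h1, h, hh, rfl⟩ := hf
  obtain ⟨k0, k1, k, hk, rfl⟩ := hg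
  refine ⟨mul_mem h0 k0, add_mem (mul_mem h0 k1) (mul_mem h1 k0),
    f1 * g1 + (f0 + d * f1 + d ^ 2 * h) * k + h * (g0 + d * g1),
    ?_, by ring⟩
  exact add_mem (add_mem (mul_mem h1.1 k1.1) (mul_mem (add_mem (add_mem h0.1 (mul_mem hd h1.1))
    (mul_mem (pow_mem hd 2) hh)) hk)) (mul_mem hh (add_mem k0.1 (mul_mem hd k1.1)))
lemma R2.sq (hd : d ∈ Pos l) {f f0 f1 : RR K n} (hf : R2 l d f f0 f1) :
    R2 l d (f ^ 2) (f0 ^ 2) (2 * f0 * f1) := by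
  have := R2.mul hd hf hf
  rw [pow_two, pow_two]
  convert this using 1
  ring
lemma R2.lin {a b w c : RR K n} (ha : a ∈ D0 l) (hb : b ∈ D0 l) (hc : c ∈ D0 l) :
    R2 l (w - c) (a + b * w) (a + b * c) b :=
  ⟨add_mem ha (mul_mem hb hc), hb, 0, zero_mem _, by ring⟩
lemma R2.gi {b w c : RR K n} (hb : b ∈ D0 l) (hc : c ∈ D0 l) (hw : w ∈ Pos l) :
    R2 l (w - c) (gi (b * w)) (gi (b * c)) (PowerSeries.X * b * gi (b * c) ^ 2) := by
  have he := gi_mem0 (mul_mem hb hc)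
  refine ⟨he, mul_mem (mul_mem X_mem0 hb) (pow_mem he 2),
    (PowerSeries.X * b) ^ 2 * LPn.gi (b * w) * LPn.gi (b * c) ^ 2,
    mul_mem (mul_mem (pow_mem (mul_mem X_mem hb.1) 2) (gi_mem (mul_mem hb.1 hw))) (pow_mem he.1 2), ?_⟩
  have h : LPn.gi (b * w) - LPn.gi (b * c) =
      PowerSeries.X * b * (w - c) * LPn.gi (b * w) * LPn.gi (b * c) := by
    linear_combination LPn.gi (b * c) * gi_mul (b * w) - LPn.gi (b * w) * gi_mul (b * c)
  linear_combination (1 + PowerSeries.X * b * (w - c) * LPn.gi (b * c)) * h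
end cong

/-- permutations -/
def pmh (s : Equiv.Perm (Fin n)) : (Fin n → ℤ) ≃+ (Fin n → ℤ) where
  toFun v := fun i => v (s.symm i)
  invFun v := fun i => v (s i)
  left_inv v := by ext i; simp
  right_inv v := by ext i; simp
  map_add' v w := rfl

def pm (s : Equiv.Perm (Fin n)) : RR K n →+* RR K n :=
  PowerSeries.map (AddMonoidAlgebra.mapDomainRingHom K (pmh s).toAddMonoidHom)

lemma pm_X (s : Equiv.Perm (Fin n)) : pm s (PowerSeries.X : RR K n) = PowerSeries.X := by
  simp [pm]

lemma CT_pm (s : Equiv.Perm (Fin n)) (f : RR K n) : CT (pm s f) = CT f := by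
  ext k
  rw [coeff_CT, coeff_CT, pm, PowerSeries.coeff_map]
  generalize PowerSeries.coeff k f = g
  induction g using AddMonoidAlgebra.induction_linear with
  | zero => simp
  | add f g hf hg => rw [map_add, map_add, hf, hg, map_add]
  | single v r =>
    have : (AddMonoidAlgebra.mapDomainRingHom K (pmh s).toAddMonoidHom)
        (AddMonoidAlgebra.single v r) = AddMonoidAlgebra.single (pmh s v) r := by
      simp
    rw [this, ct_single, ct_single]
    simp

lemma pm_mo (s : Equiv.Perm (Fin n)) (e : Fin n → ℤ) : pm s (mo e : RR K n) = mo (pmh s e) := by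
  rw [pm, mo, PowerSeries.map_C, mo]
  congr 1
  simp [mon]

def xr (i : Fin n) : RR K n := mo (Pi.single i 1)
def yr (i : Fin n) : RR K n := mo (-Pi.single i 1)

lemma pmh_single (s : Equiv.Perm (Fin n)) (i : Fin n) (a : ℤ) :
    pmh s (Pi.single i a) = Pi.single (s i) a := by
  ext j
  change (Pi.single i a : Fin n → ℤ) (s.symm j) = _
  simp only [Pi.single_apply, Equiv.symm_apply_eq]

lemma pm_xr (s : Equiv.Perm (Fin n)) (i : Fin n) : pm s (xr i : RR K n) = xr (s i) := by
  rw [xr, pm_mo, pmh_single, xr]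
lemma pm_yr (s : Equiv.Perm (Fin n)) (i : Fin n) : pm s (yr i : RR K n) = yr (s i) := by
  rw [yr, pm_mo, map_neg, pmh_single, yr]
lemma pm_gi (s : Equiv.Perm (Fin n)) (a : RR K n) : pm s (gi a) = gi (pm s a) :=
  map_gi _ (pm_X s) a

lemma xr_mul_yr (i : Fin n) : (xr i * yr i : RR K n) = 1 := by
  rw [xr, yr, mo_mul, add_neg_cancel, mo_zero]

end LPn

namespace LPn
variable {K : Type*} [Field K] {n : ℕ}

lemma mon_nsmul (w : Fin n → ℤ) (k : ℕ) : (mon (k • w) : LP K n) = mon w ^ k := by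
  induction k with
  | zero => rw [zero_smul, mon_zero, pow_zero]
  | succ k ih => rw [succ_nsmul, ← mon_mul, ih, pow_succ]

lemma coeff_gi_mo (w : Fin n → ℤ) (k : ℕ) :
    PowerSeries.coeff k (gi (mo w) : RR K n) = mon (k • w) := by
  induction k with
  | zero =>
    rw [gi_eq, map_add, PowerSeries.coeff_zero_X_mul, add_zero, zero_smul, mon_zero]; simp
  | succ k ih =>
    rw [gi_eq, map_add, PowerSeries.coeff_succ_X_mul, mo, PowerSeries.coeff_C_mul, ← mo, ih, mon_mul,
      PowerSeries.coeff_one, if_neg (by omega), zero_add, succ_nsmul, add_comm]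

lemma mon_sum {J : Type*} (s : Finset J) (f : J → Fin n → ℤ) :
    (mon (∑ j ∈ s, f j) : LP K n) = ∏ j ∈ s, mon (f j) := by
  classical
  induction s using Finset.induction_on with
  | empty => simp [mon_zero]
  | insert a s ha ih => rw [Finset.sum_insert ha, Finset.prod_insert ha, ← mon_mul, ih]

lemma coeff_gen (k : ℕ) :
    PowerSeries.coeff k (∏ v : MatVar n, gi (mo (wtv v)) : RR K n) =
      ch (fun s : Idx n k => wts s.1) (1 : Matrix (Idx n k) (Idx n k) K) := by
  rw [PowerSeries.coeff_prod]
  have : ∀ s : MatVar n →₀ ℕ, ∏ v, PowerSeries.coeff (s v) (gi (mo (wtv v)) : RR K n) = mon (wts s) := by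
    intro s
    rw [wts, mon_sum]
    refine Finset.prod_congr rfl fun v _ => ?_
    rw [coeff_gi_mo, natCast_zsmul]
  rw [Finset.sum_congr rfl fun s _ => this s, ch, ← Finset.sum_coe_sort]
  refine Finset.sum_congr rfl fun s _ => ?_
  rw [Matrix.one_apply_eq, mon]

def PK (K : Type*) [Field K] (n : ℕ) : PowerSeries K := PowerSeries.mk fun k => (pureDim1 K n k : K)

theorem gen_mol (V : LP K n) (h : ∀ k, ct (V * ch (fun s : Idx n k => wts s.1)
      (1 : Matrix (Idx n k) (Idx n k) K)) = (pureDim1 K n k : K) * ct V) :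
    CT (PowerSeries.C V * ∏ v : MatVar n, gi (mo (wtv v))) = PK K n * PowerSeries.C (ct V) := by
  ext k
  rw [coeff_CT, PowerSeries.coeff_C_mul, coeff_gen, h, PowerSeries.coeff_mul_C, PK, PowerSeries.coeff_mk]

def m (i j : Fin n) : RR K n := mo (Pi.single i 1 - Pi.single j 1)
def g (i j : Fin n) : RR K n := gi (m i j)

lemma m_eq (i j : Fin n) : (m i j : RR K n) = xr i * yr j := by
  rw [m, xr, yr, mo_mul, sub_eq_add_neg]
lemma m_self (i : Fin n) : (m i i : RR K n) = 1 := by rw [m, sub_self, mo_zero]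
lemma m_mul (i j k : Fin n) : (m i j * m j k : RR K n) = m i k := by
  rw [m, m, mo_mul, m]; congr 1; abel
lemma pm_m (s : Equiv.Perm (Fin n)) (i j : Fin n) : pm s (m i j : RR K n) = m (s i) (s j) := by
  rw [m_eq, map_mul, pm_xr, pm_yr, m_eq]
lemma pm_g (s : Equiv.Perm (Fin n)) (i j : Fin n) : pm s (g i j : RR K n) = g (s i) (s j) := by
  rw [g, pm_gi, pm_m, g]
lemma g_mul (i j : Fin n) : (1 - PowerSeries.X * m i j) * (g i j : RR K n) = 1 := gi_mul _

variable {l : (Fin n → ℤ) →+ ℤ}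
lemma m_mem0 (i j : Fin n) (h : l (Pi.single i 1 - Pi.single j 1) = 0) : (m i j : RR K n) ∈ D0 l :=
  mo_mem0 _ h

theorem lemA1 (i j : Fin n) (he : l (Pi.single i 1 - Pi.single j 1) = 1) {f f0 : RR K n}
    (hf : R1 l (m i j - PowerSeries.X) f f0) : CT (f * g j i) = CT f0 := by
  have := lemA (c := 1) (f := f) (f0 := f0) _ he (one_mem _) (by rwa [mul_one])
  rwa [one_mul, neg_sub] at this

theorem lemB1 (i j : Fin n) (he : l (Pi.single i 1 - Pi.single j 1) = 1) {f f0 f1 : RR K n}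
    (hf : R2 l (m i j - PowerSeries.X) f f0 f1) :
    CT (f * g j i ^ 2) = CT (f0 + PowerSeries.X * f1) := by
  have := lemB (c := 1) (f := f) (f0 := f0) (f1 := f1) _ he (one_mem _) (by rwa [mul_one])
  rwa [one_mul, neg_sub, mul_one] at this

def ev (i : Fin n) : (Fin n → ℤ) →+ ℤ := Pi.evalAddMonoidHom _ i
lemma ev_apply (i : Fin n) (v : Fin n → ℤ) : ev i v = v i := rfl

lemma gi_wtv (c : Fin n × Fin n) : (gi (mo (Pi.single c.2 1 - Pi.single c.1 1)) : RR K n) = g c.2 c.1 := by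
  rw [g, m]

lemma g_self (i : Fin n) : (g i i : RR K n) = gi 1 := by rw [g, m_self]

lemma prod_gen : (∏ v : MatVar n, gi (mo (wtv v)) : RR K n) = (∏ p, ∏ q, g q p) ^ 2 := by
  have h1 : (∏ c : Fin n × Fin n, gi (mo (wtv (Sum.inl c))) : RR K n) = ∏ p, ∏ q, g q p := by
    rw [Fintype.prod_prod_type]
    exact Finset.prod_congr rfl fun p _ => Finset.prod_congr rfl fun q _ => gi_wtv (p, q)
  have h2 : (∏ c : Fin n × Fin n, gi (mo (wtv (Sum.inr c))) : RR K n) = ∏ p, ∏ q, g q p := by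
    rw [Fintype.prod_prod_type]
    exact Finset.prod_congr rfl fun p _ => Finset.prod_congr rfl fun q _ => gi_wtv (p, q)
  rw [Fintype.prod_sum_type, h1, h2, pow_two]

end LPn

namespace LPn
variable {K : Type*} [Field K]

lemma core3 {R : Type*} [CommRing R] (t x0 x1 x2 y0 y1 y2 : R) (h0 : x0 * y0 = 1) (h1 : x1 * y1 = 1)
    (h2 : x2 * y2 = 1) :
    (1 + t + t ^ 2) * ((1 - x0 * y1) * (1 - x1 * y0) * (1 - x0 * y2) * (1 - x2 * y0) * (1 - x1 * y2)
      * (1 - x2 * y1)) =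
    (1 - x0 * y1) * (1 - x1 * y0) * ((1 - x0 * y2) * (1 - x1 * y2)) * ((1 - t * (x2 * y0)) * (1 - t * (x2 * y1)))
    + (1 - x0 * y2) * (1 - x2 * y0) * ((1 - x0 * y1) * (1 - x2 * y1)) * ((1 - t * (x1 * y0)) * (1 - t * (x1 * y2)))
    + (1 - x2 * y1) * (1 - x1 * y2) * ((1 - x2 * y0) * (1 - x1 * y0)) * ((1 - t * (x0 * y2)) * (1 - t * (x0 * y1))) := by
  have e : ∀ (x y z u s : R), z * y = 1 → (1 - s * (x * y)) = y * (z - s * x) := by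
    intro x y z u s h; linear_combination -h
  have e' : ∀ (x y z : R), z * y = 1 → (1 - x * y) = y * (z - x) := by
    intro x y z h; linear_combination -h
  rw [e x2 y0 x0 1 t h0, e x1 y0 x0 1 t h0, e x2 y1 x1 1 t h1, e x0 y1 x1 1 t h1, e x1 y2 x2 1 t h2, e x0 y2 x2 1 t h2,
    e' x1 y0 x0 h0, e' x2 y0 x0 h0, e' x0 y1 x1 h1, e' x2 y1 x1 h1, e' x0 y2 x2 h2, e' x1 y2 x2 h2]
  have key : (1 + t + t ^ 2) * ((x0 - x1) * (x0 - x2) * (x1 - x2)) =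
     (x0 - x1) * (x0 - t * x2) * (x1 - t * x2) - (x0 - x2) * (x0 - t * x1) * (x2 - t * x1) +
     (x1 - x2) * (x1 - t * x0) * (x2 - t * x0) := by ring
  linear_combination (- (x0 - x1) * (x0 - x2) * (x1 - x2) * y0^2 * y1^2 * y2^2) * key

lemma aux3 {R : Type*} [CommRing R] (F U0 U1 a0 a1 g0 g1 P : R) (h0 : a0 * g0 = 1) (h1 : a1 * g1 = 1)
    (hF : F = U0 * a1 + U1 * a0) :
    F * a0 * a1 * g0 ^ 2 * g1 ^ 2 * P = (U0 * g0 + U1 * g1) * P := by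
  calc _ = F * (g0 * g1) * (a0 * g0) * (a1 * g1) * P := by ring
    _ = (U0 * g0 * (a1 * g1) + U1 * g1 * (a0 * g0)) * (a0 * g0) * (a1 * g1) * P := by rw [hF]; ring
    _ = _ := by rw [h0, h1]; ring

def full3 : RR K 3 := (1 - m 0 1) * (1 - m 1 0) * (1 - m 0 2) * (1 - m 2 0) * (1 - m 1 2) * (1 - m 2 1)

lemma full3_eq : (full3 : RR K 3) = PowerSeries.C (van3 xv * van3 yv) := by
  have hx : ∀ i, (PowerSeries.C (xv i) : RR K 3) = xr i := fun i => rfl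
  have hy : ∀ i, (PowerSeries.C (yv i) : RR K 3) = yr i := fun i => rfl
  simp only [van3, map_mul, map_sub, hx, hy, full3, m_eq]
  have h0 := xr_mul_yr (K := K) (0 : Fin 3)
  have h1 := xr_mul_yr (K := K) (1 : Fin 3)
  have h2 := xr_mul_yr (K := K) (2 : Fin 3)
  have e : ∀ (x y z u : RR K 3), x * y = 1 → z * u = 1 → (1 - x * u) * (1 - z * y) = (x - z) * (y - u) := by
    intro x y z u h h'; linear_combination (z * u - 1) * h + 0 * h'
  have a := e _ _ _ _ h0 h1
  have b := e _ _ _ _ h0 h2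
  have c := e _ _ _ _ h1 h2
  calc _ = ((1 - xr 0 * yr 1) * (1 - xr 1 * yr 0)) * ((1 - xr 0 * yr 2) * (1 - xr 2 * yr 0)) *
     ((1 - xr 1 * yr 2) * (1 - xr 2 * yr 1)) := by ring
    _ = _ := by rw [a, b, c]; ring

def S3 : RR K 3 := (g 0 1 * g 1 0 * g 0 2 * g 2 0 * g 1 2 * g 2 1) ^ 2

def T3 : RR K 3 := (1 - m 0 1) * (1 - m 1 0) * ((1 - m 0 2) * (1 - m 1 2)) *
  ((1 - PowerSeries.X * m 2 0) * (1 - PowerSeries.X * m 2 1))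

lemma CTsum3 : (1 + PowerSeries.X + PowerSeries.X ^ 2) * CT (full3 * S3 : RR K 3) = 3 * CT (T3 * S3 : RR K 3) := by
  have h1 : (iot (1 + PowerSeries.X + PowerSeries.X ^ 2) : RR K 3) * (full3 * S3) =
      T3 * S3 + pm (Equiv.swap 1 2) (T3 * S3) + pm (Equiv.swap 0 2) (T3 * S3) := by
    have := core3 (PowerSeries.X : RR K 3) (xr 0) (xr 1) (xr 2) (yr 0) (yr 1) (yr 2) (xr_mul_yr _)
      (xr_mul_yr _) (xr_mul_yr _)
    simp only [← m_eq] at this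
    have s1 : (Equiv.swap 1 2 : Equiv.Perm (Fin 3)) 0 = 0 := by decide
    have s2 : (Equiv.swap 0 2 : Equiv.Perm (Fin 3)) 1 = 1 := by decide
    simp only [map_add, map_mul, map_pow, map_one, map_sub, iot_X, pm_X, T3, S3, pm_m, pm_g,
      Equiv.swap_apply_left, Equiv.swap_apply_right, s1, s2, full3]
    linear_combination (g 0 1 * g 1 0 * g 0 2 * g 2 0 * g 1 2 * g 2 1) ^ 2 * this
  rw [← CT_iot_mul, h1, map_add, map_add, CT_pm, CT_pm]
  ring

lemma CTs3 : CT (T3 * S3 : RR K 3) = 2 * CT ((1 - m 0 1) * (g 0 1) ^ 2 * (g 1 0) ^ 2 * ((1 - m 0 2) * (1 - m 1 2))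
    * ((g 0 2) ^ 2 * (g 1 2) ^ 2) * g 2 1 : RR K 3) := by
  set A : RR K 3 := (1 - m 0 1) * (g 0 1) ^ 2 * (g 1 0) ^ 2 * ((1 - m 0 2) * (1 - m 1 2))
    * ((g 0 2) ^ 2 * (g 1 2) ^ 2) * g 2 1 with hA
  have h1 : (T3 * S3 : RR K 3) = A + pm (Equiv.swap 0 1) A := by
    have s1 : (Equiv.swap 0 1 : Equiv.Perm (Fin 3)) 2 = 2 := by decide
    simp only [hA, map_mul, map_pow, map_one, map_sub, pm_m, pm_g,
      Equiv.swap_apply_left, Equiv.swap_apply_right, s1]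
    have a := g_mul (K := K) (2 : Fin 3) 0
    have b := g_mul (K := K) (2 : Fin 3) 1
    have c : (1 - m 0 1) * (1 - m 1 0 : RR K 3) = (1 - m 1 0) * (1 - PowerSeries.X * m 2 1)
        + (1 - m 0 1) * (1 - PowerSeries.X * m 2 0) := by
      linear_combination m_mul (K := K) (0 : Fin 3) 1 0 + m_self (K := K) (0 : Fin 3) 
        - PowerSeries.X * m_mul (K := K) (2 : Fin 3) 1 0 - PowerSeries.X * m_mul (K := K) (2 : Fin 3) 0 1
    have := aux3 _ _ _ _ _ _ _ ((1 - m 0 2) * (1 - m 1 2) *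
              (g 0 1 ^ 2 * g 1 0 ^ 2 * g 0 2 ^ 2 * g 1 2 ^ 2)) a b c
    rw [T3, S3]
    linear_combination this
  rw [h1, map_add, CT_pm]; ring

lemma CTA3 : CT ((1 - m 0 1) * (g 0 1) ^ 2 * (g 1 0) ^ 2 * ((1 - m 0 2) * (1 - m 1 2))
    * ((g 0 2) ^ 2 * (g 1 2) ^ 2) * g 2 1 : RR K 3) = (1 - PowerSeries.X) * gi PowerSeries.X ^ 2 *
    CT ((1 - m 0 1) * g 0 1 * (gi (PowerSeries.X * m 0 1)) ^ 2 * g 1 0 ^ 2 : RR K 3) := by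
  have hX : (PowerSeries.X : RR K 3) ∈ D0 (-ev 2) := X_mem0
  have hw : (m 1 2 : RR K 3) ∈ Pos (-ev 2) := mo_mem _ (by simp [ev_apply])
  have hd : (m 1 2 - PowerSeries.X : RR K 3) ∈ Pos (-ev 2) := sub_mem hw hX.1
  have h01 : (m 0 1 : RR K 3) ∈ D0 (-ev 2) := m_mem0 _ _ (by simp [ev_apply])
  have h10 : (m 1 0 : RR K 3) ∈ D0 (-ev 2) := m_mem0 _ _ (by simp [ev_apply])
  have r1 : R1 (-ev 2) (m 1 2 - PowerSeries.X : RR K 3) ((1 - m 0 1) * (g 0 1) ^ 2 * (g 1 0) ^ 2) _ :=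
    R1.const (mul_mem (mul_mem (sub_mem (one_mem _) h01) (pow_mem (gi_mem0 h01) 2)) (pow_mem (gi_mem0 h10) 2))
  have r2 := R1.lin (one_mem (D0 (-ev 2))) (neg_mem h01) hX (w := m 1 2)
  have r3 := R1.lin (one_mem (D0 (-ev 2))) (neg_mem (one_mem (D0 (-ev 2)))) hX (w := m 1 2)
  have r4 := (R1.gi h01 hX hw).pow hd 2
  have r5 := (R1.gi (one_mem (D0 (-ev 2))) hX hw).pow hd 2
  have e02 : (m 0 2 : RR K 3) = m 0 1 * m 1 2 := (m_mul _ _ _).symm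
  have := lemA1 (1 : Fin 3) 2 (by simp [ev_apply]) (((r1.mul hd (r2.mul hd r3)).mul hd (r4.mul hd r5)))
  simp only [g] at this ⊢
  rw [e02]
  have e1 : (1 - m 0 1 * m 1 2 : RR K 3) = 1 + -m 0 1 * m 1 2 := by ring
  have e2 : (1 - m 1 2 : RR K 3) = 1 + -1 * m 1 2 := by ring
  rw [e1, e2]
  rw [one_mul] at this
  rw [this, ← CT_iot_mul]
  refine congrArg (CT (K := K) (n := 3)) ?_
  have hgi : (gi PowerSeries.X : RR K 3) = iot (gi PowerSeries.X) := by rw [map_gi _ iot_X, iot_X]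
  rw [one_mul, hgi]
  simp only [map_mul, map_pow, map_sub, map_one, iot_X]
  have h := gi_mul (m 0 1 : RR K 3)
  rw [mul_comm (m 0 1) PowerSeries.X]
  linear_combination (1 - m 0 1) * gi (m 0 1) * gi (m 1 0) ^ 2 * (1 - PowerSeries.X) *
    gi (PowerSeries.X * m 0 1) ^ 2 * iot (gi PowerSeries.X) ^ 2 * h

lemma CTB3 : CT ((1 - m 0 1) * g 0 1 * (gi (PowerSeries.X * m 0 1)) ^ 2 * g 1 0 ^ 2 : RR K 3) =
    (1 - PowerSeries.X) * gi PowerSeries.X * gi (PowerSeries.X ^ 2) ^ 2 +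
    PowerSeries.X * (- gi PowerSeries.X * gi (PowerSeries.X ^ 2) ^ 2 +
      (1 - PowerSeries.X) * (PowerSeries.X * gi PowerSeries.X ^ 2) * gi (PowerSeries.X ^ 2) ^ 2 +
      2 * (1 - PowerSeries.X) * gi PowerSeries.X * gi (PowerSeries.X ^ 2) *
        (PowerSeries.X ^ 2 * gi (PowerSeries.X ^ 2) ^ 2)) := by
  have hX : (PowerSeries.X : RR K 3) ∈ D0 (ev 0) := X_mem0
  have h1 := (one_mem (D0 (ev 0)) : (1 : RR K 3) ∈ _)
  have hw : (m 0 1 : RR K 3) ∈ Pos (ev 0) := mo_mem _ (by simp [ev_apply])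
  have hd : (m 0 1 - PowerSeries.X : RR K 3) ∈ Pos (ev 0) := sub_mem hw hX.1
  have r1 := R2.lin h1 (neg_mem h1) hX (w := m 0 1)
  have r2 := R2.gi h1 hX hw
  have r3 := (R2.gi hX hX hw).sq hd
  have := lemB1 (0 : Fin 3) 1 (by simp [ev_apply]) ((r1.mul hd r2).mul hd r3)
  rw [one_mul, one_mul, ← pow_two, ← g, neg_one_mul, ← sub_eq_add_neg] at this
  rw [this]
  have hgi : (gi PowerSeries.X : RR K 3) = iot (gi PowerSeries.X) := by rw [map_gi _ iot_X, iot_X]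
  have hgi2 : (gi (PowerSeries.X ^ 2) : RR K 3) = iot (gi (PowerSeries.X ^ 2)) := by
    rw [map_gi _ iot_X, map_pow, iot_X]
  refine Eq.trans ?_ (CT_iot (n := 3) _)
  refine congrArg (CT (K := K) (n := 3)) ?_
  simp only [map_mul, map_pow, map_sub, map_one, iot_X, map_add, map_neg, map_ofNat, ← hgi, ← hgi2]
  ring

end LPn

namespace LPn
variable {K : Type*} [Field K]

lemma fin3f {F : Type*} [Field F] (t A e a b : F) (he : (1 - t * 1) * e = 1) (ha : (1 - t * t) * a = 1)
    (hb : (1 - t * t ^ 2) * b = 1)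
    (hA : (1 + t + t ^ 2) * A = 3 * (2 * ((1 - t) * a ^ 2 * ((1 - t) * a * b ^ 2 +
      t * (- a * b ^ 2 + (1 - t) * (t * a ^ 2) * b ^ 2 + 2 * (1 - t) * a * b * (t ^ 2 * b ^ 2)))))) :
    e ^ 6 * A * ((1 - t) ^ 2 * (1 - t ^ 2) ^ 4 * (1 - t ^ 3) ^ 4) = 6 * (1 - t ^ 2 + t ^ 4) := by
  have n1 : (1 - t) ≠ 0 := by rintro h; rw [mul_one, h, zero_mul] at he; exact zero_ne_one he
  have n2 : (1 - t * t) ≠ 0 := by rintro h; rw [h, zero_mul] at ha; exact zero_ne_one ha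
  have n3 : (1 - t * t ^ 2) ≠ 0 := by rintro h; rw [h, zero_mul] at hb; exact zero_ne_one hb
  have n4 : (1 + t) ≠ 0 := by rintro h; apply n2; linear_combination (1 - t) * h
  have n5 : (1 + t + t ^ 2) ≠ 0 := by rintro h; apply n3; linear_combination (1 - t) * h
  have he' : e = 1 / (1 - t) := by rw [eq_div_iff n1]; linear_combination he
  have ha' : a = 1 / ((1 - t) * (1 + t)) := by
    rw [eq_div_iff (mul_ne_zero n1 n4)]; linear_combination ha
  have hb' : b = 1 / ((1 - t) * (1 + t + t ^ 2)) := by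
    rw [eq_div_iff (mul_ne_zero n1 n5)]; linear_combination hb
  have hA' : A = (3 * (2 * ((1 - t) * a ^ 2 * ((1 - t) * a * b ^ 2 +
      t * (- a * b ^ 2 + (1 - t) * (t * a ^ 2) * b ^ 2 + 2 * (1 - t) * a * b * (t ^ 2 * b ^ 2)))))) /
      (1 + t + t ^ 2) := by rw [eq_div_iff n5]; linear_combination hA
  rw [hA', he', ha', hb']
  have f2 : 1 - t ^ 2 = (1 - t) * (1 + t) := by ring
  have f3 : 1 - t ^ 3 = (1 - t) * (1 + t + t ^ 2) := by ring
  rw [f2, f3]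
  field_simp
  ring

lemma fin3 {R : Type*} [CommRing R] [IsDomain R] (t A e a b : R) (he : (1 - t * 1) * e = 1) (ha : (1 - t * t) * a = 1)
    (hb : (1 - t * t ^ 2) * b = 1)
    (hA : (1 + t + t ^ 2) * A = 3 * (2 * ((1 - t) * a ^ 2 * ((1 - t) * a * b ^ 2 +
      t * (- a * b ^ 2 + (1 - t) * (t * a ^ 2) * b ^ 2 + 2 * (1 - t) * a * b * (t ^ 2 * b ^ 2)))))) :
    e ^ 6 * A * ((1 - t) ^ 2 * (1 - t ^ 2) ^ 4 * (1 - t ^ 3) ^ 4) = 6 * (1 - t ^ 2 + t ^ 4) := by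
  obtain ⟨f, hf⟩ : ∃ f : R →+* FractionRing R, Function.Injective f :=
    ⟨algebraMap R (FractionRing R), IsFractionRing.injective R (FractionRing R)⟩
  have he := congrArg f he
  have ha := congrArg f ha
  have hb := congrArg f hb
  have hA := congrArg f hA
  apply hf
  simp only [map_mul, map_sub, map_add, map_neg, map_pow, map_one, map_ofNat] at he ha hb hA ⊢
  exact fin3f (f t) (f A) (f e) (f a) (f b) he ha hb hA

lemma kap {n : ℕ} (V : LP K n) (h : ∀ k, ct (V * ch (fun s : Idx n k => wts s.1)
      (1 : Matrix (Idx n k) (Idx n k) K)) = (pureDim1 K n k : K) * ct V) :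
    PowerSeries.constantCoeff (PK K n * PowerSeries.C (ct V)) = ct V := by
  rw [← gen_mol V h, ← PowerSeries.coeff_zero_eq_constantCoeff_apply, coeff_CT,
    PowerSeries.coeff_C_mul]
  have : PowerSeries.coeff 0 (∏ v : MatVar n, gi (mo (wtv v)) : RR K n) = 1 := by
    rw [PowerSeries.coeff_zero_eq_constantCoeff_apply, map_prod]
    refine Finset.prod_eq_one fun v _ => ?_
    rw [← PowerSeries.coeff_zero_eq_constantCoeff_apply, coeff_gi_mo, zero_smul, mon_zero]
  rw [this, mul_one]

/-- conclusion from the renormalized identity -/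
lemma concl {n : ℕ} (V : LP K n) (h : ∀ k, ct (V * ch (fun s : Idx n k => wts s.1)
      (1 : Matrix (Idx n k) (Idx n k) K)) = (pureDim1 K n k : K) * ct V) (N : ℕ) (hN : (N : K) ≠ 0)
    (den num : PowerSeries K) (hd : PowerSeries.constantCoeff den = 1)
    (hn : PowerSeries.constantCoeff num = 1)
    (e : PK K n * PowerSeries.C (ct V) * den = N * num) : PK K n * den = num := by
  have h1 := congrArg PowerSeries.constantCoeff e
  rw [map_mul, kap V h, map_mul, hd, hn, map_natCast, mul_one, mul_one] at h1
  rw [h1, map_natCast] at e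
  have hN' : (N : PowerSeries K) ≠ 0 := by
    intro h0; apply hN
    have := congrArg PowerSeries.constantCoeff h0
    simpa using this
  apply mul_left_cancel₀ hN'
  rw [← e]; ring

/-- transfer to rational coefficients -/
lemma transfer [CharZero K] {n : ℕ} (den num : PowerSeries ℚ)
    (e : PK K n * PowerSeries.map (algebraMap ℚ K) den = PowerSeries.map (algebraMap ℚ K) num) :
    purePS1 K n * den = num := by
  have hinj : Function.Injective (PowerSeries.map (algebraMap ℚ K)) :=
    PowerSeries.map_injective _ (algebraMap ℚ K).injective
  apply hinj
  rw [map_mul, ← e]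
  congr 1
  ext k
  simp [purePS1, PK]

theorem res3 [CharZero K] :
    purePS1 K 3 * ((1 - pu) ^ 2 * (1 - pu ^ 2) ^ 4 * (1 - pu ^ 3) ^ 4) =
      1 - pu ^ 2 + pu ^ 4 := by
  apply transfer
  have hX : PowerSeries.map (algebraMap ℚ K) pu = PowerSeries.X := by simp [pu]
  simp only [map_add, map_sub, map_mul, map_pow, map_one, hX]
  have h := mol3 (K := K)
  refine concl (van3 xv * van3 yv) h 6 (by norm_num) _ _ (by simp) (by simp) ?_
  rw [← gen_mol _ h, ← full3_eq, prod_gen]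
  have hg : (full3 * (∏ p, ∏ q, g q p) ^ 2 : RR K 3) = iot (gi 1 ^ 6) * (full3 * S3) := by
    have hgi : (iot (gi 1) : RR K 3) = gi 1 := by rw [map_gi _ iot_X, map_one]
    simp only [Fin.prod_univ_three, g_self, S3, map_pow, hgi]
    ring
  rw [hg, CT_iot_mul]
  have := CTsum3 (K := K)
  rw [CTs3, CTA3, CTB3] at this
  push_cast
  exact fin3 _ _ _ _ _ (gi_mul _) (gi_mul _) (gi_mul _) this

end LPn

namespace LPn
variable {K : Type*} [Field K]

section
variable {n : ℕ}
def q (i j : Fin n) : RR K n := 1 - m i j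
def r (i j : Fin n) : RR K n := 1 - PowerSeries.X * m i j
lemma q_eq (i j : Fin n) : (q i j : RR K n) = 1 - xr i * yr j := by rw [q, m_eq]
lemma r_eq (i j : Fin n) : (r i j : RR K n) = 1 - PowerSeries.X * (xr i * yr j) := by rw [r, m_eq]
lemma pm_q (s : Equiv.Perm (Fin n)) (i j : Fin n) : pm s (q i j : RR K n) = q (s i) (s j) := by
  rw [q, map_sub, map_one, pm_m, q]
lemma pm_r (s : Equiv.Perm (Fin n)) (i j : Fin n) : pm s (r i j : RR K n) = r (s i) (s j) := by
  rw [r, map_sub, map_one, map_mul, pm_X, pm_m, r]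
lemma r_mul_g (i j : Fin n) : (r i j * g i j : RR K n) = 1 := g_mul i j
lemma iot_gi (s : PowerSeries K) : (iot (gi s) : RR K n) = gi (iot s) := map_gi _ iot_X s
end

lemma eq1 {R : Type*} [CommRing R] (x y z u d : R) (h : x * y = 1) (h' : z * u = 1) (hd : x - z = d) :
    1 - x * u = -(u * d) ∧ 1 - z * y = y * d := by
  subst hd
  exact ⟨by linear_combination -h', by linear_combination -h⟩

lemma eq2 {R : Type*} [CommRing R] (t x y z p : R) (h : x * y = 1) (hp : x - t * z = p) :
    1 - t * (z * y) = y * p := by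
  subst hp
  linear_combination -h

lemma core4 {R : Type*} [CommRing R] (t x0 x1 x2 x3 y0 y1 y2 y3 : R) (h0 : x0 * y0 = 1) (h1 : x1 * y1 = 1)
    (h2 : x2 * y2 = 1) (h3 : x3 * y3 = 1) :
    (1 + t + t ^ 2 + t ^ 3) * ((1 - x0 * y1) * (1 - x1 * y0) * (1 - x0 * y2) * (1 - x2 * y0) * (1 - x1 * y2)
      * (1 - x2 * y1) * ((1 - x0 * y3) * (1 - x1 * y3) * (1 - x2 * y3)) *
        ((1 - x3 * y0) * (1 - x3 * y1) * (1 - x3 * y2))) =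
    (1 - x0 * y1) * (1 - x1 * y0) * (1 - x0 * y2) * (1 - x2 * y0) * (1 - x1 * y2)
      * (1 - x2 * y1) * ((1 - x0 * y3) * (1 - x1 * y3) * (1 - x2 * y3)) *
        ((1 - t * (x3 * y0)) * (1 - t * (x3 * y1)) * (1 - t * (x3 * y2))) +
    (1 - x3 * y1) * (1 - x1 * y3) * (1 - x3 * y2) * (1 - x2 * y3) * (1 - x1 * y2)
      * (1 - x2 * y1) * ((1 - x3 * y0) * (1 - x1 * y0) * (1 - x2 * y0)) *
        ((1 - t * (x0 * y3)) * (1 - t * (x0 * y1)) * (1 - t * (x0 * y2))) +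
    (1 - x0 * y3) * (1 - x3 * y0) * (1 - x0 * y2) * (1 - x2 * y0) * (1 - x3 * y2)
      * (1 - x2 * y3) * ((1 - x0 * y1) * (1 - x3 * y1) * (1 - x2 * y1)) *
        ((1 - t * (x1 * y0)) * (1 - t * (x1 * y3)) * (1 - t * (x1 * y2))) +
    (1 - x0 * y1) * (1 - x1 * y0) * (1 - x0 * y3) * (1 - x3 * y0) * (1 - x1 * y3)
      * (1 - x3 * y1) * ((1 - x0 * y2) * (1 - x1 * y2) * (1 - x3 * y2)) *
        ((1 - t * (x2 * y0)) * (1 - t * (x2 * y1)) * (1 - t * (x2 * y3))) := by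
  have key : (1 + t + t ^ 2 + t ^ 3) * ((x0 - x1) * (x0 - x2) * (x1 - x2) * (x0 - x3) * (x1 - x3) * (x2 - x3)) =
     (x0 - x1) * (x0 - x2) * (x1 - x2) * (x0 - t * x3) * (x1 - t * x3) * (x2 - t * x3) -
     (x0 - x1) * (x0 - x3) * (x1 - x3) * (x0 - t * x2) * (x1 - t * x2) * (x3 - t * x2) +
     (x0 - x2) * (x0 - x3) * (x2 - x3) * (x0 - t * x1) * (x2 - t * x1) * (x3 - t * x1) -
     (x1 - x2) * (x1 - x3) * (x2 - x3) * (x1 - t * x0) * (x2 - t * x0) * (x3 - t * x0) := by ring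
  obtain ⟨d01, e01⟩ : ∃ d, x0 - x1 = d := ⟨_, rfl⟩
  obtain ⟨d02, e02⟩ : ∃ d, x0 - x2 = d := ⟨_, rfl⟩
  obtain ⟨d03, e03⟩ : ∃ d, x0 - x3 = d := ⟨_, rfl⟩
  obtain ⟨d12, e12⟩ : ∃ d, x1 - x2 = d := ⟨_, rfl⟩
  obtain ⟨d13, e13⟩ : ∃ d, x1 - x3 = d := ⟨_, rfl⟩
  obtain ⟨d23, e23⟩ : ∃ d, x2 - x3 = d := ⟨_, rfl⟩
  obtain ⟨p03, f03⟩ : ∃ d, x0 - t * x3 = d := ⟨_, rfl⟩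
  obtain ⟨p13, f13⟩ : ∃ d, x1 - t * x3 = d := ⟨_, rfl⟩
  obtain ⟨p23, f23⟩ : ∃ d, x2 - t * x3 = d := ⟨_, rfl⟩
  obtain ⟨p02, f02⟩ : ∃ d, x0 - t * x2 = d := ⟨_, rfl⟩
  obtain ⟨p12, f12⟩ : ∃ d, x1 - t * x2 = d := ⟨_, rfl⟩
  obtain ⟨p32, f32⟩ : ∃ d, x3 - t * x2 = d := ⟨_, rfl⟩
  obtain ⟨p01, f01⟩ : ∃ d, x0 - t * x1 = d := ⟨_, rfl⟩
  obtain ⟨p21, f21⟩ : ∃ d, x2 - t * x1 = d := ⟨_, rfl⟩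
  obtain ⟨p31, f31⟩ : ∃ d, x3 - t * x1 = d := ⟨_, rfl⟩
  obtain ⟨p10, f10⟩ : ∃ d, x1 - t * x0 = d := ⟨_, rfl⟩
  obtain ⟨p20, f20⟩ : ∃ d, x2 - t * x0 = d := ⟨_, rfl⟩
  obtain ⟨p30, f30⟩ : ∃ d, x3 - t * x0 = d := ⟨_, rfl⟩
  rw [e01, e02, e03, e12, e13, e23, f03, f13, f23, f02, f12, f32, f01, f21, f31, f10, f20, f30] at key
  rw [(eq1 _ _ _ _ _ h0 h1 e01).1, (eq1 _ _ _ _ _ h0 h1 e01).2, (eq1 _ _ _ _ _ h0 h2 e02).1,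
    (eq1 _ _ _ _ _ h0 h2 e02).2, (eq1 _ _ _ _ _ h0 h3 e03).1, (eq1 _ _ _ _ _ h0 h3 e03).2,
    (eq1 _ _ _ _ _ h1 h2 e12).1, (eq1 _ _ _ _ _ h1 h2 e12).2, (eq1 _ _ _ _ _ h1 h3 e13).1,
    (eq1 _ _ _ _ _ h1 h3 e13).2, (eq1 _ _ _ _ _ h2 h3 e23).1, (eq1 _ _ _ _ _ h2 h3 e23).2,
    eq2 _ _ _ _ _ h0 f03, eq2 _ _ _ _ _ h1 f13, eq2 _ _ _ _ _ h2 f23, eq2 _ _ _ _ _ h0 f02,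
    eq2 _ _ _ _ _ h1 f12, eq2 _ _ _ _ _ h3 f32, eq2 _ _ _ _ _ h0 f01, eq2 _ _ _ _ _ h2 f21,
    eq2 _ _ _ _ _ h3 f31, eq2 _ _ _ _ _ h1 f10, eq2 _ _ _ _ _ h2 f20, eq2 _ _ _ _ _ h3 f30]
  linear_combination (d01 * d02 * d03 * d12 * d13 * d23 * (y0 * y1 * y2 * y3) ^ 3) * key

lemma core4b {R : Type*} [CommRing R] (t x0 x1 x2 x3 y0 y1 y2 : R) (h0 : x0 * y0 = 1) (h1 : x1 * y1 = 1)
    (h2 : x2 * y2 = 1) :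
    (1 - x0 * y1) * (1 - x1 * y0) * (1 - x0 * y2) * (1 - x2 * y0) * (1 - x1 * y2) * (1 - x2 * y1) =
    (1 - x2 * y1) * (1 - x1 * y2) * ((1 - x2 * y0) * (1 - x1 * y0)) *
      ((1 - t * (x3 * y1)) * (1 - t * (x3 * y2))) +
    (1 - x0 * y2) * (1 - x2 * y0) * ((1 - x0 * y1) * (1 - x2 * y1)) *
      ((1 - t * (x3 * y0)) * (1 - t * (x3 * y2))) +
    (1 - x0 * y1) * (1 - x1 * y0) * ((1 - x0 * y2) * (1 - x1 * y2)) *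
      ((1 - t * (x3 * y0)) * (1 - t * (x3 * y1))) := by
  have key : ((x0 - x1) * (x0 - x2) * (x1 - x2)) =
     (x0 - x1) * (x0 - t * x3) * (x1 - t * x3) -
     (x0 - x2) * (x0 - t * x3) * (x2 - t * x3) +
     (x1 - x2) * (x1 - t * x3) * (x2 - t * x3) := by ring
  obtain ⟨d01, e01⟩ : ∃ d, x0 - x1 = d := ⟨_, rfl⟩
  obtain ⟨d02, e02⟩ : ∃ d, x0 - x2 = d := ⟨_, rfl⟩
  obtain ⟨d12, e12⟩ : ∃ d, x1 - x2 = d := ⟨_, rfl⟩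
  obtain ⟨p03, f03⟩ : ∃ d, x0 - t * x3 = d := ⟨_, rfl⟩
  obtain ⟨p13, f13⟩ : ∃ d, x1 - t * x3 = d := ⟨_, rfl⟩
  obtain ⟨p23, f23⟩ : ∃ d, x2 - t * x3 = d := ⟨_, rfl⟩
  rw [e01, e02, e12, f03, f13, f23] at key
  rw [(eq1 _ _ _ _ _ h0 h1 e01).1, (eq1 _ _ _ _ _ h0 h1 e01).2, (eq1 _ _ _ _ _ h0 h2 e02).1,
    (eq1 _ _ _ _ _ h0 h2 e02).2,
    (eq1 _ _ _ _ _ h1 h2 e12).1, (eq1 _ _ _ _ _ h1 h2 e12).2,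
    eq2 _ _ _ _ _ h0 f03, eq2 _ _ _ _ _ h1 f13, eq2 _ _ _ _ _ h2 f23]
  linear_combination (-d01 * d02 * d12 * (y0 * y1 * y2) ^ 2) * key

lemma aux4 {R : Type*} [CommRing R] (F U0 U1 U2 a0 a1 a2 g0 g1 g2 P : R) (h0 : a0 * g0 = 1) (h1 : a1 * g1 = 1)
    (h2 : a2 * g2 = 1) (hF : F = U0 * (a1 * a2) + U1 * (a0 * a2) + U2 * (a0 * a1)) :
    F * a0 * a1 * a2 * g0 ^ 2 * g1 ^ 2 * g2 ^ 2 * P = (U0 * g0 + U1 * g1 + U2 * g2) * P := by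
  calc _ = F * (g0 * g1 * g2) * (a0 * g0) * (a1 * g1) * (a2 * g2) * P := by ring
    _ = (U0 * g0 * ((a1 * g1) * (a2 * g2)) + U1 * g1 * ((a0 * g0) * (a2 * g2))
        + U2 * g2 * ((a0 * g0) * (a1 * g1))) * (a0 * g0) * (a1 * g1) * (a2 * g2) * P := by rw [hF]; ring
    _ = _ := by rw [h0, h1, h2]; ring

def full4 : RR K 4 := q 0 1 * q 1 0 * q 0 2 * q 2 0 * q 1 2 * q 2 1 * (q 0 3 * q 1 3 * q 2 3) *
  (q 3 0 * q 3 1 * q 3 2)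

lemma full4_eq : (full4 : RR K 4) = PowerSeries.C (van4 xv * van4 yv) := by
  have hx : ∀ i, (PowerSeries.C (xv i) : RR K 4) = xr i := fun i => rfl
  have hy : ∀ i, (PowerSeries.C (yv i) : RR K 4) = yr i := fun i => rfl
  simp only [van4, map_mul, map_sub, hx, hy, full4]
  have e : ∀ i j : Fin 4, (q i j * q j i : RR K 4) = (xr i - xr j) * (yr i - yr j) := by
    intro i j
    rw [q_eq, q_eq]
    linear_combination (xr j * yr j - 1) * xr_mul_yr (K := K) i
  calc _ = (q 0 1 * q 1 0) * (q 0 2 * q 2 0) * (q 0 3 * q 3 0) * (q 1 2 * q 2 1) * (q 1 3 * q 3 1) *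
        (q 2 3 * q 3 2) := by ring
    _ = _ := by
      rw [e, e, e, e, e, e]
      generalize (xr 0 - xr 1 : RR K 4) = a1, (xr 0 - xr 2 : RR K 4) = a2, (xr 0 - xr 3 : RR K 4) = a3,
        (xr 1 - xr 2 : RR K 4) = a4, (xr 1 - xr 3 : RR K 4) = a5, (xr 2 - xr 3 : RR K 4) = a6,
        (yr 0 - yr 1 : RR K 4) = b1, (yr 0 - yr 2 : RR K 4) = b2, (yr 0 - yr 3 : RR K 4) = b3,
        (yr 1 - yr 2 : RR K 4) = b4, (yr 1 - yr 3 : RR K 4) = b5, (yr 2 - yr 3 : RR K 4) = b6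
      ring

def S4 : RR K 4 := (g 0 1 * g 1 0 * g 0 2 * g 2 0 * g 1 2 * g 2 1 * (g 0 3 * g 1 3 * g 2 3) *
  (g 3 0 * g 3 1 * g 3 2)) ^ 2

def T4 : RR K 4 := q 0 1 * q 1 0 * q 0 2 * q 2 0 * q 1 2 * q 2 1 * (q 0 3 * q 1 3 * q 2 3) *
  (r 3 0 * r 3 1 * r 3 2)

lemma CTsum4 : (1 + PowerSeries.X + PowerSeries.X ^ 2 + PowerSeries.X ^ 3) * CT (full4 * S4 : RR K 4) =
    4 * CT (T4 * S4 : RR K 4) := by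
  have h1 : (iot (1 + PowerSeries.X + PowerSeries.X ^ 2 + PowerSeries.X ^ 3) : RR K 4) * (full4 * S4) =
      T4 * S4 + pm (Equiv.swap 0 3) (T4 * S4) + pm (Equiv.swap 1 3) (T4 * S4)
        + pm (Equiv.swap 2 3) (T4 * S4) := by
    have := core4 (PowerSeries.X : RR K 4) (xr 0) (xr 1) (xr 2) (xr 3) (yr 0) (yr 1) (yr 2) (yr 3)
      (xr_mul_yr _) (xr_mul_yr _) (xr_mul_yr _) (xr_mul_yr _)
    simp only [← r_eq, ← q_eq] at this
    have s1 : (Equiv.swap 0 3 : Equiv.Perm (Fin 4)) 1 = 1 := by decide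
    have s2 : (Equiv.swap 0 3 : Equiv.Perm (Fin 4)) 2 = 2 := by decide
    have s3 : (Equiv.swap 1 3 : Equiv.Perm (Fin 4)) 0 = 0 := by decide
    have s4 : (Equiv.swap 1 3 : Equiv.Perm (Fin 4)) 2 = 2 := by decide
    have s5 : (Equiv.swap 2 3 : Equiv.Perm (Fin 4)) 0 = 0 := by decide
    have s6 : (Equiv.swap 2 3 : Equiv.Perm (Fin 4)) 1 = 1 := by decide
    simp only [map_add, map_mul, map_pow, map_one, iot_X, T4, S4, pm_q, pm_r, pm_g,
      Equiv.swap_apply_left, Equiv.swap_apply_right, s1, s2, s3, s4, s5, s6, full4]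
    linear_combination (g 0 1 * g 1 0 * g 0 2 * g 2 0 * g 1 2 * g 2 1 * (g 0 3 * g 1 3 * g 2 3) *
  (g 3 0 * g 3 1 * g 3 2)) ^ 2 * this
  rw [← CT_iot_mul, h1, map_add, map_add, map_add, CT_pm, CT_pm, CT_pm]
  ring

/-- the representative term -/
def A4 : RR K 4 := q 0 1 * q 1 0 * (q 0 2 * q 1 2) * (g 0 1 ^ 2 * g 1 0 ^ 2 * g 0 2 ^ 2 * g 2 0 ^ 2 *
  g 1 2 ^ 2 * g 2 1 ^ 2) * (q 0 3 * q 1 3 * q 2 3) * (g 0 3 ^ 2 * g 1 3 ^ 2 * g 2 3 ^ 2) * g 3 2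

lemma CTs4 : CT (T4 * S4 : RR K 4) = 3 * CT (A4 : RR K 4) := by
  have h1 : (T4 * S4 : RR K 4) = A4 + pm (Equiv.swap 0 2) A4 + pm (Equiv.swap 1 2) A4 := by
    have s1 : (Equiv.swap 0 2 : Equiv.Perm (Fin 4)) 1 = 1 := by decide
    have s2 : (Equiv.swap 0 2 : Equiv.Perm (Fin 4)) 3 = 3 := by decide
    have s3 : (Equiv.swap 1 2 : Equiv.Perm (Fin 4)) 0 = 0 := by decide
    have s4 : (Equiv.swap 1 2 : Equiv.Perm (Fin 4)) 3 = 3 := by decide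
    simp only [A4, map_mul, map_pow, pm_q, pm_g,
      Equiv.swap_apply_left, Equiv.swap_apply_right, s1, s2, s3, s4]
    have c := core4b (PowerSeries.X : RR K 4) (xr 0) (xr 1) (xr 2) (xr 3) (yr 0) (yr 1) (yr 2)
      (xr_mul_yr _) (xr_mul_yr _) (xr_mul_yr _)
    simp only [← r_eq, ← q_eq] at c
    have := aux4 _ _ _ _ _ _ _ _ _ _ (q 0 3 * q 1 3 * q 2 3 *
        (g 0 1 ^ 2 * g 1 0 ^ 2 * g 0 2 ^ 2 * g 2 0 ^ 2 *
          g 1 2 ^ 2 * g 2 1 ^ 2) * (g 0 3 ^ 2 * g 1 3 ^ 2 * g 2 3 ^ 2)) (r_mul_g (K := K) 3 0)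
          (r_mul_g 3 1) (r_mul_g 3 2) c
    rw [T4, S4]
    linear_combination this
  rw [h1, map_add, map_add, CT_pm, CT_pm]; ring

def F4 : RR K 4 := q 0 1 * q 1 0 * (g 0 1 ^ 2 * g 1 0 ^ 2) * (q 0 2 * q 1 2 * (g 0 2 * g 1 2)) *
  (gi (PowerSeries.X * m 0 2) ^ 2 * gi (PowerSeries.X * m 1 2) ^ 2) * (g 2 0 ^ 2 * g 2 1 ^ 2)

lemma CTA4 : CT (A4 : RR K 4) = (1 - PowerSeries.X) * gi PowerSeries.X ^ 2 * CT (F4 : RR K 4) := by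
  have hX : (PowerSeries.X : RR K 4) ∈ D0 (-ev 3) := X_mem0
  have h1 := (one_mem (D0 (-ev 3)) : (1 : RR K 4) ∈ _)
  have hw : (m 2 3 : RR K 4) ∈ Pos (-ev 3) := mo_mem _ (by simp [ev_apply])
  have hd : (m 2 3 - PowerSeries.X : RR K 4) ∈ Pos (-ev 3) := sub_mem hw hX.1
  have h01 : (m 0 1 : RR K 4) ∈ D0 (-ev 3) := m_mem0 _ _ (by simp [ev_apply])
  have h10 : (m 1 0 : RR K 4) ∈ D0 (-ev 3) := m_mem0 _ _ (by simp [ev_apply])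
  have h02 : (m 0 2 : RR K 4) ∈ D0 (-ev 3) := m_mem0 _ _ (by simp [ev_apply])
  have h20 : (m 2 0 : RR K 4) ∈ D0 (-ev 3) := m_mem0 _ _ (by simp [ev_apply])
  have h12 : (m 1 2 : RR K 4) ∈ D0 (-ev 3) := m_mem0 _ _ (by simp [ev_apply])
  have h21 : (m 2 1 : RR K 4) ∈ D0 (-ev 3) := m_mem0 _ _ (by simp [ev_apply])
  have hq : ∀ i j : Fin 4, (m i j : RR K 4) ∈ D0 (-ev 3) → (q i j : RR K 4) ∈ D0 (-ev 3) :=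
    fun i j h => sub_mem h1 h
  have hg : ∀ i j : Fin 4, (m i j : RR K 4) ∈ D0 (-ev 3) → (g i j ^ 2 : RR K 4) ∈ D0 (-ev 3) :=
    fun i j h => pow_mem (gi_mem0 h) 2
  have r1 : R1 (-ev 3) (m 2 3 - PowerSeries.X : RR K 4) (q 0 1 * q 1 0 * (q 0 2 * q 1 2) *
      (g 0 1 ^ 2 * g 1 0 ^ 2 * g 0 2 ^ 2 * g 2 0 ^ 2 * g 1 2 ^ 2 * g 2 1 ^ 2)) _ :=
    R1.const (mul_mem (mul_mem (mul_mem (hq _ _ h01) (hq _ _ h10)) (mul_mem (hq _ _ h02) (hq _ _ h12)))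
      (mul_mem (mul_mem (mul_mem (mul_mem (mul_mem (hg _ _ h01) (hg _ _ h10)) (hg _ _ h02)) (hg _ _ h20))
        (hg _ _ h12)) (hg _ _ h21)))
  have e : ∀ i : Fin 4, (q i 3 : RR K 4) = 1 + -m i 2 * m 2 3 := by
    intro i; rw [q, ← m_mul i 2 3]; ring
  have e' : ∀ i : Fin 4, (g i 3 : RR K 4) = gi (m i 2 * m 2 3) := by
    intro i; rw [g, ← m_mul i 2 3]
  have rq : ∀ i, (m i 2 : RR K 4) ∈ D0 (-ev 3) →
      R1 (-ev 3) (m 2 3 - PowerSeries.X : RR K 4) (q i 3) (r i 2) := by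
    intro i hi
    have := R1.lin h1 (neg_mem hi) hX (w := m 2 3)
    rw [← e] at this
    convert this using 1
    rw [r]; ring
  have rg : ∀ i, (m i 2 : RR K 4) ∈ D0 (-ev 3) →
      R1 (-ev 3) (m 2 3 - PowerSeries.X : RR K 4) (g i 3 ^ 2) (gi (PowerSeries.X * m i 2) ^ 2) := by
    intro i hi
    have := (R1.gi hi hX hw).pow hd 2
    rwa [← e', mul_comm (m i 2)] at this
  have h22 : (m 2 2 : RR K 4) ∈ D0 (-ev 3) := by rw [m_self]; exact h1
  have := lemA1 (2 : Fin 4) 3 (by simp [ev_apply])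
    ((r1.mul hd (((rq 0 h02).mul hd (rq 1 h12)).mul hd (rq 2 h22))).mul hd
      (((rg 0 h02).mul hd (rg 1 h12)).mul hd (rg 2 h22)))
  rw [A4, this, ← CT_iot_mul]
  refine congrArg (CT (K := K) (n := 4)) ?_
  have e2 : (r 2 2 : RR K 4) = 1 - PowerSeries.X := by rw [r, m_self, mul_one]
  rw [map_mul, map_pow, iot_gi, map_sub, map_one, iot_X, e2, m_self, mul_one, F4]
  have a := r_mul_g (K := K) (0 : Fin 4) 2
  have b := r_mul_g (K := K) (1 : Fin 4) 2
  calc _ = (1 - PowerSeries.X) * gi PowerSeries.X ^ 2 * (q 0 1 * q 1 0 * (g 0 1 ^ 2 * g 1 0 ^ 2) *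
     (q 0 2 * q 1 2 * (g 0 2 * g 1 2)) *
  (gi (PowerSeries.X * m 0 2) ^ 2 * gi (PowerSeries.X * m 1 2) ^ 2) * (g 2 0 ^ 2 * g 2 1 ^ 2)) *
    ((r 0 2 * g 0 2) * (r 1 2 * g 1 2)) := by ring
    _ = _ := by rw [a, b, mul_one, mul_one]

def G4 : RR K 4 := q 0 1 * (1 + PowerSeries.X ^ 2 * m 0 1) * g 0 1 ^ 2 * (q 0 2 * q 1 2 * (g 0 2 * g 1 2)) *
  (gi (PowerSeries.X * m 0 2) ^ 2 * gi (PowerSeries.X * m 1 2) ^ 2) * (g 2 0 ^ 2 * g 2 1 ^ 2)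

lemma sym4 {R : Type*} [CommRing R] (t u v : R) (h : u * v = 1) :
    (1 - t * v) ^ 2 * (1 - u) * (1 + t ^ 2 * u) + (1 - t * u) ^ 2 * (1 - v) * (1 + t ^ 2 * v) =
    (1 - t ^ 2) * (1 + t) ^ 2 * ((1 - u) * (1 - v)) := by
  grind

lemma CTF4 : (1 - PowerSeries.X ^ 2) * (1 + PowerSeries.X) ^ 2 * CT (F4 : RR K 4) = 2 * CT (G4 : RR K 4) := by
  have h1 : (iot ((1 - PowerSeries.X ^ 2) * (1 + PowerSeries.X) ^ 2) : RR K 4) * F4 =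
      G4 + pm (Equiv.swap 0 1) G4 := by
    have s1 : (Equiv.swap 0 1 : Equiv.Perm (Fin 4)) 2 = 2 := by decide
    simp only [G4, F4, map_add, map_sub, map_mul, map_pow, map_one, iot_X, pm_X, pm_q, pm_g, pm_m, pm_gi,
      Equiv.swap_apply_left, Equiv.swap_apply_right, s1]
    have hu : (m 0 1 * m 1 0 : RR K 4) = 1 := by rw [m_mul, m_self]
    have s := sym4 (PowerSeries.X : RR K 4) _ _ hu
    have a := r_mul_g (K := K) (0 : Fin 4) 1
    have b := r_mul_g (K := K) (1 : Fin 4) 0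
    change (r 1 0) ^ 2 * q 0 1 * _ + (r 0 1) ^ 2 * q 1 0 * _ = _ * _ * (q 0 1 * q 1 0) at s
    generalize (1 + PowerSeries.X ^ 2 * m 0 1 : RR K 4) = z0 at *
    generalize (1 + PowerSeries.X ^ 2 * m 1 0 : RR K 4) = z1 at *
    generalize ((1 - PowerSeries.X ^ 2) * (1 + PowerSeries.X) ^ 2 : RR K 4) = c at *
    calc _ = (c * (q 0 1 * q 1 0)) * ((g 0 1 ^ 2 * g 1 0 ^ 2) * (q 0 2 * q 1 2 * (g 0 2 * g 1 2)) *
      (gi (PowerSeries.X * m 0 2) ^ 2 * gi (PowerSeries.X * m 1 2) ^ 2) * (g 2 0 ^ 2 * g 2 1 ^ 2)) := by ring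
      _ = (q 0 1 * z0 * g 0 1 ^ 2 * (r 1 0 * g 1 0) ^ 2 + q 1 0 * z1 * g 1 0 ^ 2 * (r 0 1 * g 0 1) ^ 2) *
       ((q 0 2 * q 1 2 * (g 0 2 * g 1 2)) *
      (gi (PowerSeries.X * m 0 2) ^ 2 * gi (PowerSeries.X * m 1 2) ^ 2) * (g 2 0 ^ 2 * g 2 1 ^ 2)) := by
        rw [← s]; ring
      _ = _ := by rw [a, b]; ring
  rw [← CT_iot_mul, h1, map_add, CT_pm]
  ring

end LPn

namespace LPn
variable {K : Type*} [Field K]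

lemma alg5 {R : Type*} [CommRing R] (t v k a b P k0 k1 : R) (hk : (1 - t * (t * v)) * k = 1)
    (h1 : k1 = (1 - t) * a * b ^ 2)
    (h0 : k0 = (1 - t) * a * b ^ 2 + t * (-a * b ^ 2 + (1 - t) * (t * a ^ 2) * b ^ 2 +
      2 * (1 - t) * a * (t ^ 2 * b ^ 3))) :
    ((1 + -v * t) * (1 + t ^ 2 * v * t) * k ^ 2 * ((1 + -1 * t) * a * b ^ 2)) * P +
     t * (((1 + -v * t) * (1 + t ^ 2 * v * t) * k ^ 2 * ((1 + -1 * t) * a * (2 * b * (t * t * b ^ 2)) +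
        ((1 + -1 * t) * (t * 1 * a ^ 2) + -1 * a) * b ^ 2) +
       ((1 + -v * t) * (1 + t ^ 2 * v * t) * (2 * k * (t * v * k ^ 2)) +
        ((1 + -v * t) * (t ^ 2 * v) + -v * (1 + t ^ 2 * v * t)) * k ^ 2) * ((1 + -1 * t) * a * b ^ 2)) * P) =
    (k0 + v * (((t ^ 3 - t - t ^ 2) * k0 + (t ^ 3 - t + 2 * t ^ 2) * k1) +
      v * ((t ^ 3 - t ^ 4 - t ^ 5) * k0 + (t ^ 5 - 2 * t ^ 4 - t ^ 3) * k1 +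
      v * (t ^ 6 * k0)))) * k ^ 3 * P := by
  subst h1 h0
  have hk2 : k ^ 2 = (1 - t * (t * v)) * k ^ 3 := by linear_combination -k ^ 2 * hk
  linear_combination (((1 + -v * t) * (1 + t ^ 2 * v * t) * ((1 + -1 * t) * a * b ^ 2)) * P +
     t * (((1 + -v * t) * (1 + t ^ 2 * v * t) * ((1 + -1 * t) * a * (2 * b * (t * t * b ^ 2)) +
        ((1 + -1 * t) * (t * 1 * a ^ 2) + -1 * a) * b ^ 2) +
       (((1 + -v * t) * (t ^ 2 * v) + -v * (1 + t ^ 2 * v * t))) * ((1 + -1 * t) * a * b ^ 2)) * P)) * hk2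

def kk1 : PowerSeries K := (1 - PowerSeries.X) * gi PowerSeries.X * gi (PowerSeries.X ^ 2) ^ 2
def kk0 : PowerSeries K := (1 - PowerSeries.X) * gi PowerSeries.X * gi (PowerSeries.X ^ 2) ^ 2 +
  PowerSeries.X * (-gi PowerSeries.X * gi (PowerSeries.X ^ 2) ^ 2 +
   (1 - PowerSeries.X) * (PowerSeries.X * gi PowerSeries.X ^ 2) * gi (PowerSeries.X ^ 2) ^ 2 +
      2 * (1 - PowerSeries.X) * gi PowerSeries.X * (PowerSeries.X ^ 2 * gi (PowerSeries.X ^ 2) ^ 3))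
def ss1 : PowerSeries K := (PowerSeries.X ^ 3 - PowerSeries.X - PowerSeries.X ^ 2) * kk0 +
  (PowerSeries.X ^ 3 - PowerSeries.X + 2 * PowerSeries.X ^ 2) * kk1
def ss2 : PowerSeries K := (PowerSeries.X ^ 3 - PowerSeries.X ^ 4 - PowerSeries.X ^ 5) * kk0 +
  (PowerSeries.X ^ 5 - 2 * PowerSeries.X ^ 4 - PowerSeries.X ^ 3) * kk1
def ss3 : PowerSeries K := PowerSeries.X ^ 6 * kk0

lemma CTG4 : CT (G4 : RR K 4) = CT ((iot kk0 + m 2 1 * (iot ss1 + m 2 1 * (iot ss2 + m 2 1 * iot ss3))) *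
    gi (PowerSeries.X * m 2 1) ^ 3 *
    (q 1 2 * g 1 2 * gi (PowerSeries.X * m 1 2) ^ 2 * g 2 1 ^ 2) : RR K 4) := by
  have hX : (PowerSeries.X : RR K 4) ∈ D0 (ev 0) := X_mem0
  have h1 := (one_mem (D0 (ev 0)) : (1 : RR K 4) ∈ _)
  have hw : (m 0 2 : RR K 4) ∈ Pos (ev 0) := mo_mem _ (by simp [ev_apply])
  have hd : (m 0 2 - PowerSeries.X : RR K 4) ∈ Pos (ev 0) := sub_mem hw hX.1
  have h12 : (m 1 2 : RR K 4) ∈ D0 (ev 0) := m_mem0 _ _ (by simp [ev_apply])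
  have h21 : (m 2 1 : RR K 4) ∈ D0 (ev 0) := m_mem0 _ _ (by simp [ev_apply])
  have e01 : (m 0 1 : RR K 4) = m 2 1 * m 0 2 := by rw [mul_comm, m_mul]
  have hP : (q 1 2 * g 1 2 * gi (PowerSeries.X * m 1 2) ^ 2 * g 2 1 ^ 2 : RR K 4) ∈ D0 (ev 0) :=
    mul_mem (mul_mem (mul_mem (sub_mem h1 h12) (gi_mem0 h12)) (pow_mem (gi_mem0 (mul_mem hX h12)) 2))
      (pow_mem (gi_mem0 h21) 2)
  generalize hPP : (q 1 2 * g 1 2 * gi (PowerSeries.X * m 1 2) ^ 2 * g 2 1 ^ 2 : RR K 4) = P at *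
  have rA := R2.lin h1 (neg_mem h21) hX (w := m 0 2)
  have rB := R2.lin h1 (mul_mem (pow_mem hX 2) h21) hX (w := m 0 2)
  have rC := (R2.gi h21 hX hw).sq hd
  have rD := R2.lin h1 (neg_mem h1) hX (w := m 0 2)
  have rE := R2.gi h1 hX hw
  have rH := (R2.gi hX hX hw).sq hd
  have rP : R2 (ev 0) (m 0 2 - PowerSeries.X : RR K 4) P P 0 := R2.const hP
  have := lemB1 (0 : Fin 4) 2 (by simp [ev_apply])
    (((((rA.mul hd rB).mul hd rC).mul hd ((rD.mul hd rE).mul hd rH))).mul hd rP)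
  refine Eq.trans (congrArg (CT (K := K) (n := 4)) ?_) (this.trans (congrArg (CT (K := K) (n := 4)) ?_))
  · have g01 : (g 0 1 : RR K 4) = gi (m 2 1 * m 0 2) := by rw [g, e01]
    have g02 : (gi (1 * m 0 2) : RR K 4) = g 0 2 := by rw [one_mul]; rfl
    have q01 : (q 0 1 : RR K 4) = 1 + -m 2 1 * m 0 2 := by rw [q, e01]; ring
    have q02 : (q 0 2 : RR K 4) = 1 + -1 * m 0 2 := by rw [q]; ring
    rw [G4, ← hPP, g02, g01, q01, q02, e01]
    ring
  · have a1 : (gi (PowerSeries.X) : RR K 4) = iot (gi PowerSeries.X) := by rw [iot_gi, iot_X]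
    have a2 : (gi (PowerSeries.X ^ 2) : RR K 4) = iot (gi (PowerSeries.X ^ 2)) := by
      rw [iot_gi, map_pow, iot_X]
    rw [one_mul, ← pow_two PowerSeries.X, a1, a2, mul_comm (m 2 1) PowerSeries.X]
    have := alg5 (PowerSeries.X : RR K 4) (m 2 1) (gi (PowerSeries.X * m 2 1)) (iot (gi PowerSeries.X))
      (iot (gi (PowerSeries.X ^ 2))) P (iot kk0) (iot kk1) (gi_mul _)
      (by simp only [kk1, map_add, map_sub, map_mul, map_pow, map_one, iot_X])
      (by simp only [kk0, map_add, map_sub, map_mul, map_pow, map_one, map_neg, map_ofNat, iot_X])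
    have e1 : (iot ss1 : RR K 4) = (PowerSeries.X ^ 3 - PowerSeries.X - PowerSeries.X ^ 2) * iot kk0 +
      (PowerSeries.X ^ 3 - PowerSeries.X + 2 * PowerSeries.X ^ 2) * iot kk1 := by
      simp only [ss1, map_add, map_sub, map_mul, map_pow, map_ofNat, iot_X]
    have e2 : (iot ss2 : RR K 4) = (PowerSeries.X ^ 3 - PowerSeries.X ^ 4 - PowerSeries.X ^ 5) * iot kk0 +
      (PowerSeries.X ^ 5 - 2 * PowerSeries.X ^ 4 - PowerSeries.X ^ 3) * iot kk1 := by
      simp only [ss2, map_add, map_sub, map_mul, map_pow, map_ofNat, iot_X]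
    have e3 : (iot ss3 : RR K 4) = PowerSeries.X ^ 6 * iot kk0 := by
      simp only [ss3, map_mul, map_pow, iot_X]
    rw [e1, e2, e3, ← this]
    ring

end LPn

namespace LPn
variable {K : Type*} [Field K]

section
variable {n : ℕ} {l : (Fin n → ℤ) →+ ℤ}
lemma R1.cub {w c a b p s : RR K n} (hw : w ∈ Pos l) (hc : c ∈ D0 l) (ha : a ∈ D0 l) (hb : b ∈ D0 l)
    (hp : p ∈ D0 l) (hs : s ∈ D0 l) :
    R1 l (w - c) (a + w * (b + w * (p + w * s))) (a + c * (b + c * (p + c * s))) :=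
  ⟨add_mem ha (mul_mem hc (add_mem hb (mul_mem hc (add_mem hp (mul_mem hc hs))))),
    b + p * (w + c) + s * (w * w + w * c + c * c),
    add_mem (add_mem hb.1 (mul_mem hp.1 (add_mem hw hc.1)))
      (mul_mem hs.1 (add_mem (add_mem (mul_mem hw hw) (mul_mem hw hc.1)) (mul_mem hc.1 hc.1))), by ring⟩

lemma R2.cub {w c a b p s : RR K n} (hw : w ∈ Pos l) (hc : c ∈ D0 l) (ha : a ∈ D0 l) (hb : b ∈ D0 l)
    (hp : p ∈ D0 l) (hs : s ∈ D0 l) :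
    R2 l (w - c) (a + w * (b + w * (p + w * s))) (a + c * (b + c * (p + c * s)))
      (b + c * (p + p + c * (s + s + s))) :=
  ⟨add_mem ha (mul_mem hc (add_mem hb (mul_mem hc (add_mem hp (mul_mem hc hs))))),
    add_mem hb (mul_mem hc (add_mem (add_mem hp hp) (mul_mem hc (add_mem (add_mem hs hs) hs)))),
    p + s * (w + c + c),
    add_mem hp.1 (mul_mem hs.1 (add_mem (add_mem hw hc.1) hc.1)), by ring⟩
end

lemma pf4 {R : Type*} [CommRing R] (t v g h : R) (hg : (1 - t * v) * g = 1)
    (hh : (1 - t * (t * v)) * h = 1) :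
    t * (1 - t) * ((1 - v) * g * h ^ 2) = -g + t * h + (1 - t ^ 2) * h ^ 2 := by
  linear_combination (-g * ((1 - t * (t * v)) * h + 1)) * hh +
    t * h * (((1 - t * (t * v)) * h) * hg + hh) + (1 - t ^ 2) * h ^ 2 * hg

def MM (c : PowerSeries K) : PowerSeries K := kk0 + c * (ss1 + c * (ss2 + c * ss3))
def MD (c : PowerSeries K) : PowerSeries K := ss1 + c * (ss2 + ss2 + c * (ss3 + ss3 + ss3))

lemma CTG4b : PowerSeries.X * (1 - PowerSeries.X) * CT (G4 : RR K 4) =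
    -(MM PowerSeries.X * gi (PowerSeries.X * PowerSeries.X) ^ 3 * gi PowerSeries.X ^ 2) +
    PowerSeries.X * (MM (PowerSeries.X * PowerSeries.X) * gi (PowerSeries.X * (PowerSeries.X * PowerSeries.X)) ^ 3
      * gi (PowerSeries.X * PowerSeries.X) ^ 2) +
    (1 - PowerSeries.X ^ 2) * (MM (PowerSeries.X * PowerSeries.X) *
      gi (PowerSeries.X * (PowerSeries.X * PowerSeries.X)) ^ 3
      * gi (PowerSeries.X * PowerSeries.X) ^ 2 + PowerSeries.X * PowerSeries.X *
       (MD (PowerSeries.X * PowerSeries.X) * gi (PowerSeries.X * (PowerSeries.X * PowerSeries.X)) ^ 3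
          * gi (PowerSeries.X * PowerSeries.X) ^ 2 +
        MM (PowerSeries.X * PowerSeries.X) * (3 * PowerSeries.X ^ 2 *
          gi (PowerSeries.X * (PowerSeries.X * PowerSeries.X)) ^ 4)
          * gi (PowerSeries.X * PowerSeries.X) ^ 2 +
        MM (PowerSeries.X * PowerSeries.X) * gi (PowerSeries.X * (PowerSeries.X * PowerSeries.X)) ^ 3
          * (2 * PowerSeries.X * gi (PowerSeries.X * PowerSeries.X) ^ 3)) : PowerSeries K) := by
  have hX : (PowerSeries.X : RR K 4) ∈ D0 (ev 2) := X_mem0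
  have hXX : (PowerSeries.X * PowerSeries.X : RR K 4) ∈ D0 (ev 2) := mul_mem hX hX
  have h1 := (one_mem (D0 (ev 2)) : (1 : RR K 4) ∈ _)
  have hw : (m 2 1 : RR K 4) ∈ Pos (ev 2) := mo_mem _ (by simp [ev_apply])
  have hd : (m 2 1 - PowerSeries.X : RR K 4) ∈ Pos (ev 2) := sub_mem hw hX.1
  have hd2 : (m 2 1 - PowerSeries.X * PowerSeries.X : RR K 4) ∈ Pos (ev 2) := sub_mem hw hXX.1
  have he : (ev (2 : Fin 4)) (Pi.single 2 1 - Pi.single 1 1) = 1 := by simp [ev_apply]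
  have t1 := lemA1 (K := K) (2 : Fin 4) 1 he
    (((R1.cub hw hX (iot_mem0 kk0) (iot_mem0 ss1) (iot_mem0 ss2) (iot_mem0 ss3)).mul hd
      ((R1.gi hX hX hw).pow hd 3)).mul hd ((R1.gi h1 hX hw).pow hd 2))
  have t2 := lemA (K := K) _ he hX
    (((R1.cub hw hXX (iot_mem0 kk0) (iot_mem0 ss1) (iot_mem0 ss2) (iot_mem0 ss3)).mul hd2
      ((R1.gi hX hXX hw).pow hd2 3)).mul hd2 ((R1.gi h1 hXX hw).pow hd2 2))
  have rg := R2.gi hX hXX hw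
  have t3 := lemB (K := K) _ he hX
    (((R2.cub hw hXX (iot_mem0 kk0) (iot_mem0 ss1) (iot_mem0 ss2) (iot_mem0 ss3)).mul hd2
      ((rg.sq hd2).mul hd2 rg)).mul hd2 ((R2.gi h1 hXX hw).sq hd2))
  rw [neg_sub, ← m] at t2 t3
  rw [CTG4, ← CT_iot_mul]
  have hk := pf4 _ _ _ _ (g_mul (K := K) (1 : Fin 4) 2) (gi_mul (PowerSeries.X * m 1 2))
  rw [← q] at hk
  obtain ⟨M, hM⟩ : ∃ M : RR K 4, M = (iot kk0 + m 2 1 * (iot ss1 + m 2 1 * (iot ss2 + m 2 1 * iot ss3))) :=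
    ⟨_, rfl⟩
  have hg1 : (gi (1 * m 2 1) : RR K 4) = g 2 1 := by rw [one_mul]; rfl
  rw [← hM, hg1] at t1 t2 t3
  rw [← hM]
  have e : (iot (PowerSeries.X * (1 - PowerSeries.X)) * (M * gi (PowerSeries.X * m 2 1) ^ 3 *
    (q 1 2 * g 1 2 * gi (PowerSeries.X * m 1 2) ^ 2 * g 2 1 ^ 2)) : RR K 4) =
    -(M * gi (PowerSeries.X * m 2 1) ^ 3 * g 2 1 ^ 2 * g 1 2) +
    iot PowerSeries.X * (M * gi (PowerSeries.X * m 2 1) ^ 3 * g 2 1 ^ 2 * gi (PowerSeries.X * m 1 2)) +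
    iot (1 - PowerSeries.X ^ 2) * (M * (gi (PowerSeries.X * m 2 1) ^ 2 * gi (PowerSeries.X * m 2 1))
       * g 2 1 ^ 2 * gi (PowerSeries.X * m 1 2) ^ 2) := by
    rw [map_mul, map_sub, map_sub, map_one, map_pow, iot_X]
    linear_combination (M * gi (PowerSeries.X * m 2 1) ^ 3 * g 2 1 ^ 2) * hk
  rw [e, map_add, map_add, map_neg, CT_iot_mul, CT_iot_mul, t1, t2, t3]
  have u1 : ∀ s : RR K 4, ∀ s' : PowerSeries K, s = iot s' → CT s = s' := by
    rintro _ s' rfl; exact CT_iot _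
  rw [u1 _ (MM PowerSeries.X * gi (PowerSeries.X * PowerSeries.X) ^ 3 * gi (1 * PowerSeries.X) ^ 2) (by
      simp only [MM, map_add, map_mul, map_pow, map_one, iot_X, iot_gi]),
    u1 _ (MM (PowerSeries.X * PowerSeries.X) * gi (PowerSeries.X * (PowerSeries.X * PowerSeries.X)) ^ 3
      * gi (1 * (PowerSeries.X * PowerSeries.X)) ^ 2) (by
      simp only [MM, map_add, map_mul, map_pow, map_one, iot_X, iot_gi]),
    u1 _ (MM (PowerSeries.X * PowerSeries.X) *
      gi (PowerSeries.X * (PowerSeries.X * PowerSeries.X)) ^ 3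
      * gi (1 * (PowerSeries.X * PowerSeries.X)) ^ 2 + PowerSeries.X * PowerSeries.X *
       (MD (PowerSeries.X * PowerSeries.X) * gi (PowerSeries.X * (PowerSeries.X * PowerSeries.X)) ^ 3
          * gi (1 * (PowerSeries.X * PowerSeries.X)) ^ 2 +
        MM (PowerSeries.X * PowerSeries.X) * (3 * PowerSeries.X ^ 2 *
          gi (PowerSeries.X * (PowerSeries.X * PowerSeries.X)) ^ 4)
          * gi (1 * (PowerSeries.X * PowerSeries.X)) ^ 2 +
        MM (PowerSeries.X * PowerSeries.X) * gi (PowerSeries.X * (PowerSeries.X * PowerSeries.X)) ^ 3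
          * (2 * PowerSeries.X * gi (1 * (PowerSeries.X * PowerSeries.X)) ^ 3))) (by
      simp only [MM, MD, map_add, map_mul, map_pow, map_one, map_ofNat, iot_X, iot_gi]; ring)]
  simp only [one_mul]

end LPn

namespace LPn
variable {K : Type*} [Field K]

lemma fin4f {F : Type*} [Field F] (t A e a B C Z : F) (ht : t ≠ 0) (n1 : 1 - t ≠ 0)
    (n4 : 1 + t ≠ 0) (n5 : 1 + t + t ^ 2 ≠ 0) (n6 : 1 + t ^ 2 ≠ 0)
    (he : e = 1 / (1 - t)) (ha : a = 1 / ((1 - t) * (1 + t)))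
    (hA : (1 + t + t ^ 2 + t ^ 3) * A = 4 * (3 * ((1 - t) * a ^ 2 * B)))
    (hB : (1 - t ^ 2) * (1 + t) ^ 2 * B = 2 * C)
    (hC : t * (1 - t) * C = Z) (N : F)
    (hZ : Z = t * N / ((1 - t) ^ 6 * (1 + t) ^ 3 * (1 + t ^ 2) ^ 4 * (1 + t + t ^ 2) ^ 5)) :
    e ^ 8 * A * ((1 - t) ^ 3 * (1 - t ^ 2) ^ 4 * (1 - t ^ 3) ^ 5 * (1 - t ^ 4) ^ 5) = 24 * N := by
  have f2 : 1 - t ^ 2 = (1 - t) * (1 + t) := by ring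
  have f3 : 1 - t ^ 3 = (1 - t) * (1 + t + t ^ 2) := by ring
  have f4 : 1 - t ^ 4 = (1 - t) * (1 + t) * (1 + t ^ 2) := by ring
  have f5 : 1 + t + t ^ 2 + t ^ 3 = (1 + t) * (1 + t ^ 2) := by ring
  rw [f5] at hA
  rw [f2] at hB
  have hC' : C = Z / (t * (1 - t)) := by
    rw [eq_div_iff (mul_ne_zero ht n1)]; linear_combination hC
  have hB' : B = 2 * C / ((1 - t) * (1 + t) ^ 3) := by
    rw [eq_div_iff (mul_ne_zero n1 (pow_ne_zero _ n4))]; linear_combination hB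
  have hA' : A = 12 * ((1 - t) * a ^ 2 * B) / ((1 + t) * (1 + t ^ 2)) := by
    rw [eq_div_iff (mul_ne_zero n4 n6)]; linear_combination hA
  rw [f2, f3, f4, hA', hB', hC', hZ, he, ha]
  field_simp
  ring

lemma finZ {F : Type*} [Field F] (t a b d k0 k1 Z M1 M2 M3 : F)  (n1 : 1 - t ≠ 0) (n4 : 1 + t ≠ 0)
    (n5 : 1 + t + t ^ 2 ≠ 0) (n6 : 1 + t ^ 2 ≠ 0)
    (ha : a = 1 / ((1 - t) * (1 + t)))
    (hb : b = 1 / ((1 - t) * (1 + t + t ^ 2))) (hd : d = 1 / ((1 - t) * (1 + t) * (1 + t ^ 2)))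
    (h1 : k1 = (1 - t) * a * b ^ 2)
    (h0 : k0 = (1 - t) * a * b ^ 2 + t * (-a * b ^ 2 + (1 - t) * (t * a ^ 2) * b ^ 2 +
      2 * (1 - t) * a * (t ^ 2 * b ^ 3)))
    (s1 s2 s3 : F) (hs1 : s1 = (t ^ 3 - t - t ^ 2) * k0 + (t ^ 3 - t + 2 * t ^ 2) * k1)
    (hs2 : s2 = (t ^ 3 - t ^ 4 - t ^ 5) * k0 + (t ^ 5 - 2 * t ^ 4 - t ^ 3) * k1)
    (hs3 : s3 = t ^ 6 * k0)
    (hM1 : M1 = k0 + t * (s1 + t * (s2 + t * s3)))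
    (hM2 : M2 = k0 + t * t * (s1 + t * t * (s2 + t * t * s3)))
    (hM3 : M3 = s1 + t * t * (s2 + s2 + t * t * (s3 + s3 + s3)))
    (hZ : Z = -(M1 * b ^ 3 * a ^ 2) + t * (M2 * d ^ 3 * b ^ 2) + (1 - t ^ 2) * (M2 * d ^ 3 * b ^ 2 +
      t * t * (M3 * d ^ 3 * b ^ 2 + M2 * (3 * t ^ 2 * d ^ 4) * b ^ 2 + M2 * d ^ 3 * (2 * t * b ^ 3)))) :
    Z = t * ((1 - t ^ 2 + t ^ 4) * (1 - t - t ^ 3 + t ^ 4 + 2 * t ^ 5 + t ^ 6 - t ^ 7 - t ^ 9 + t ^ 10)) /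
      ((1 - t) ^ 6 * (1 + t) ^ 3 * (1 + t ^ 2) ^ 4 * (1 + t + t ^ 2) ^ 5) := by
  obtain ⟨k, hk⟩ : ∃ k, k = 1 / ((1 - t) ^ 3 * (1 + t) ^ 2 * (1 + t + t ^ 2) ^ 3) := ⟨_, rfl⟩
  have k0' : k0 = (1 - t ^ 2 + t ^ 4) * k := by
    rw [h0, ha, hb, hk]
    field_simp
    ring
  have k1' : k1 = (1 - t) * (1 + t) * (1 + t + t ^ 2) * k := by
    rw [h1, ha, hb, hk]
    field_simp
  rw [k0', k1'] at hs1 hs2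
  rw [k0'] at hs3
  rw [k0', hs1, hs2, hs3] at hM1 hM2
  rw [hs1, hs2, hs3] at hM3
  rw [hZ, hM1, hM2, hM3, ha, hb, hd, hk]
  field_simp
  ring

lemma fin4 {R : Type*} [CommRing R] [IsDomain R] (t A e a b d k0 k1 s1 s2 s3 M1 M2 M3 B C : R) (ht : t ≠ 0)
    (he : (1 - t * 1) * e = 1) (ha : (1 - t * t) * a = 1)
    (hb : (1 - t * (t * t)) * b = 1) (hd : (1 - t * (t * (t * t))) * d = 1)
    (hA : (1 + t + t ^ 2 + t ^ 3) * A = 4 * (3 * ((1 - t) * a ^ 2 * B)))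
    (hB : (1 - t ^ 2) * (1 + t) ^ 2 * B = 2 * C)
    (h1 : k1 = (1 - t) * a * b ^ 2)
    (h0 : k0 = (1 - t) * a * b ^ 2 + t * (-a * b ^ 2 + (1 - t) * (t * a ^ 2) * b ^ 2 +
      2 * (1 - t) * a * (t ^ 2 * b ^ 3)))
    (hs1 : s1 = (t ^ 3 - t - t ^ 2) * k0 + (t ^ 3 - t + 2 * t ^ 2) * k1)
    (hs2 : s2 = (t ^ 3 - t ^ 4 - t ^ 5) * k0 + (t ^ 5 - 2 * t ^ 4 - t ^ 3) * k1)
    (hs3 : s3 = t ^ 6 * k0)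
    (hM1 : M1 = k0 + t * (s1 + t * (s2 + t * s3)))
    (hM2 : M2 = k0 + t * t * (s1 + t * t * (s2 + t * t * s3)))
    (hM3 : M3 = s1 + t * t * (s2 + s2 + t * t * (s3 + s3 + s3)))
    (hC : t * (1 - t) * C = -(M1 * b ^ 3 * a ^ 2) + t * (M2 * d ^ 3 * b ^ 2) + (1 - t ^ 2) * (M2 * d ^ 3 * b ^ 2 +
      t * t * (M3 * d ^ 3 * b ^ 2 + M2 * (3 * t ^ 2 * d ^ 4) * b ^ 2 + M2 * d ^ 3 * (2 * t * b ^ 3)))) :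
    e ^ 8 * A * ((1 - t) ^ 3 * (1 - t ^ 2) ^ 4 * (1 - t ^ 3) ^ 5 * (1 - t ^ 4) ^ 5) =
      24 * ((1 - t ^ 2 + t ^ 4) * (1 - t - t ^ 3 + t ^ 4 + 2 * t ^ 5 + t ^ 6 - t ^ 7 - t ^ 9 + t ^ 10)) := by
  obtain ⟨f, hf⟩ : ∃ f : R →+* FractionRing R, Function.Injective f :=
    ⟨algebraMap R (FractionRing R), IsFractionRing.injective R (FractionRing R)⟩
  have ht' : f t ≠ 0 := by rw [← map_zero f]; exact hf.ne ht
  have he := congrArg f he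
  have ha := congrArg f ha
  have hb := congrArg f hb
  have hd := congrArg f hd
  have hA := congrArg f hA
  have hB := congrArg f hB
  have hC := congrArg f hC
  have h1 := congrArg f h1
  have h0 := congrArg f h0
  have hs1 := congrArg f hs1
  have hs2 := congrArg f hs2
  have hs3 := congrArg f hs3
  have hM1 := congrArg f hM1
  have hM2 := congrArg f hM2
  have hM3 := congrArg f hM3
  apply hf
  simp only [map_mul, map_sub, map_add, map_neg, map_pow, map_one, map_ofNat] at he ha hb hd hA hB hC h1 h0 hs1 hs2 hs3 hM1 hM2 hM3 ⊢
  generalize f t = t at *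
  have n1 : (1 - t) ≠ 0 := by rintro h; rw [mul_one, h, zero_mul] at he; exact zero_ne_one he
  have n2 : (1 - t * t) ≠ 0 := by rintro h; rw [h, zero_mul] at ha; exact zero_ne_one ha
  have n3 : (1 - t * (t * t)) ≠ 0 := by rintro h; rw [h, zero_mul] at hb; exact zero_ne_one hb
  have n4' : (1 - t * (t * (t * t))) ≠ 0 := by rintro h; rw [h, zero_mul] at hd; exact zero_ne_one hd
  have n4 : (1 + t) ≠ 0 := by rintro h; apply n2; linear_combination (1 - t) * h
  have n5 : (1 + t + t ^ 2) ≠ 0 := by rintro h; apply n3; linear_combination (1 - t) * h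
  have n6 : (1 + t ^ 2) ≠ 0 := by rintro h; apply n4'; linear_combination (1 - t ^ 2) * h
  have he' : f e = 1 / (1 - t) := by rw [eq_div_iff n1]; linear_combination he
  have ha' : f a = 1 / ((1 - t) * (1 + t)) := by
    rw [eq_div_iff (mul_ne_zero n1 n4)]; linear_combination ha
  have hb' : f b = 1 / ((1 - t) * (1 + t + t ^ 2)) := by
    rw [eq_div_iff (mul_ne_zero n1 n5)]; linear_combination hb
  have hd' : f d = 1 / ((1 - t) * (1 + t) * (1 + t ^ 2)) := by
    rw [eq_div_iff (mul_ne_zero (mul_ne_zero n1 n4) n6)]; linear_combination hd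
  exact fin4f t (f A) (f e) (f a) (f B) (f C) _ ht' n1 n4 n5 n6 he' ha' hA hB hC _
    (finZ t (f a) (f b) (f d) (f k0) (f k1) _ (f M1) (f M2) (f M3) n1 n4 n5 n6 ha' hb' hd' h1 h0
      (f s1) (f s2) (f s3) hs1 hs2 hs3 hM1 hM2 hM3 rfl)

theorem res4 [CharZero K] :
    purePS1 K 4 * ((1 - pu) ^ 3 * (1 - pu ^ 2) ^ 4 * (1 - pu ^ 3) ^ 5 * (1 - pu ^ 4) ^ 5) =
      (1 - pu ^ 2 + pu ^ 4) *
        (1 - pu - pu ^ 3 + pu ^ 4 + 2 * pu ^ 5 + pu ^ 6 - pu ^ 7 - pu ^ 9 + pu ^ 10) := by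
  apply transfer
  have hX : PowerSeries.map (algebraMap ℚ K) pu = PowerSeries.X := by simp [pu]
  simp only [map_add, map_sub, map_mul, map_pow, map_one, map_ofNat, hX]
  have h := mol4 (K := K)
  refine concl (van4 xv * van4 yv) h 24 (by norm_num) _ _ (by simp) (by simp) ?_
  rw [← gen_mol _ h, ← full4_eq, prod_gen]
  have hg : (full4 * (∏ p, ∏ q, g q p) ^ 2 : RR K 4) = iot (gi 1 ^ 8) * (full4 * S4) := by
    have hgi : (iot (gi 1) : RR K 4) = gi 1 := by rw [map_gi _ iot_X, map_one]
    simp only [Fin.prod_univ_four, g_self, S4, map_pow, hgi]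
    ring
  rw [hg, CT_iot_mul]
  have := CTsum4 (K := K)
  rw [CTs4, CTA4] at this
  have e2 : (PowerSeries.X ^ 2 : PowerSeries K) = PowerSeries.X * PowerSeries.X := pow_two _
  push_cast
  refine fin4 PowerSeries.X _ _ _ _ _ kk0 kk1 ss1 ss2 ss3 _ _ _ _ _ PowerSeries.X_ne_zero (gi_mul _) (gi_mul _) (gi_mul _)
    (gi_mul _) this CTF4 ?_ ?_ rfl rfl rfl rfl rfl rfl CTG4b
  · rw [kk1, e2]
  · rw [kk0, e2]

end LPn

/-- The simply graded Poincaré series of the pure trace algebras of two generic `3 × 3`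
and `4 × 4` matrices are
`P(C_{3,2}; t) = (1 − t² + t⁴) / ((1−t)²(1−t²)⁴(1−t³)⁴)` and
`P(C_{4,2}; t) = (1 − t² + t⁴)(1 − t − t³ + t⁴ + 2t⁵ + t⁶ − t⁷ − t⁹ + t¹⁰) /
((1−t)³(1−t²)⁴(1−t³)⁵(1−t⁴)⁵)`. -/
theorem poincare_C32_C42_single (K : Type*) [Field K] [CharZero K] :
    purePS1 K 3 * ((1 - pu) ^ 2 * (1 - pu ^ 2) ^ 4 * (1 - pu ^ 3) ^ 4) =
      1 - pu ^ 2 + pu ^ 4 ∧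
    purePS1 K 4 * ((1 - pu) ^ 3 * (1 - pu ^ 2) ^ 4 * (1 - pu ^ 3) ^ 5 * (1 - pu ^ 4) ^ 5) =
      (1 - pu ^ 2 + pu ^ 4) *
        (1 - pu - pu ^ 3 + pu ^ 4 + 2 * pu ^ 5 + pu ^ 6 - pu ^ 7 - pu ^ 9 + pu ^ 10) := by
  exact ⟨LPn.res3, LPn.res4⟩
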